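/- arXiv:1404.7738 — 5 statements merged into one kernel-verified Lean document; each statement's English description precedes it below -/
import Mathlib

section
/- Fix $\varepsilon > 0$. There exists a constant $C$ depending only on $\varepsilon$ such that for all real numbers $D_1, D_2, D_3, D_4, B_1, B_2, B_3, B_4 \geq 1/2$, the number $\mathcal{N}$ of tuples $(d_1,d_2,d_3,d_4,b_1,b_2,b_3,b_4) \in \mathbb{Z}_{\geq 1}^8$ satisfying $D_i < d_i \leq 2 D_i$ and $B_i \leq b_i \leq 2 B_i$ for $i \in \{1,2,3,4\}$, with $d_1 d_2 d_3 d_4$ squarefree, $\gcd(d_1 b_1, d_2 b_2) = 1$, and the equations $d_2 b_2^2 - d_1 b_1^2 = d_3 b_3^2$ and $d_2 b_2^2 + d_1 b_1^2 = d_4 b_4^2$, satisfies $\mathcal{N} \leq C (D_1 D_2 D_3 D_4)^{1/2 + \varepsilon} (B_1 B_2 B_3 B_4)^{1/4}$. -/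
structure PellSol (σ κ p q r x y z : ℤ) : Prop where
  hp : 0 < p
  hq : 0 < q
  hr : 0 < r
  hx : 0 < x
  hy : 0 < y
  hz : 0 < z
  sp : Squarefree p
  sq : Squarefree q
  sr : Squarefree r
  cpq : IsCoprime p q
  cpr : IsCoprime p r
  cqr : IsCoprime q r
  cxy : IsCoprime x y
  cxz : IsCoprime x z
  cyz : IsCoprime y z
  lt : p * x ^ 2 < q * y ^ 2
  eq : q * y ^ 2 + σ * (p * x ^ 2) = κ * (r * z ^ 2)

structure PellBox (P Q R X Y Z : ℝ) (p q r x y z : ℤ) : Prop where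
  p1 : P ≤ p
  p2 : (p : ℝ) ≤ 2 * P
  q1 : Q ≤ q
  q2 : (q : ℝ) ≤ 2 * Q
  r1 : R ≤ r
  r2 : (r : ℝ) ≤ 2 * R
  x1 : X ≤ x
  x2 : (x : ℝ) ≤ 2 * X
  y1 : Y ≤ y
  y2 : (y : ℝ) ≤ 2 * Y
  z1 : Z ≤ z
  z2 : (z : ℝ) ≤ 2 * Z

lemma pell_tau (ε : ℝ) (hε : 0 < ε) : ∃ C : ℝ, 1 ≤ C ∧ ∀ n : ℕ, Squarefree n →
    (n.divisors.card : ℝ) ≤ C * (n : ℝ) ^ ε := by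
  obtain ⟨M, hM⟩ := exists_nat_ge ((2 : ℝ) ^ (1 / ε))
  refine ⟨2 ^ M, one_le_pow₀ (by norm_num), fun n hn => ?_⟩
  have hn0 : n ≠ 0 := hn.ne_zero
  have h1 : n.divisors.card ≤ 2 ^ n.primeFactors.card := by
    rw [Nat.card_divisors hn0, ← Finset.prod_const]
    exact Finset.prod_le_prod' (fun p _ => by
      have := hn.natFactorization_le_one p
      omega)
  have h2 : ((n : ℝ)) ^ ε = ∏ p ∈ n.primeFactors, (p : ℝ) ^ ε := by
    rw [Real.finsetProd_rpow _ _ (fun i _ => Nat.cast_nonneg i), ← Nat.cast_prod,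
      Nat.prod_primeFactors_of_squarefree hn]
  rw [h2]
  refine (Nat.cast_le.2 h1).trans ?_
  have h3 : ∀ p ∈ n.primeFactors, (2 : ℝ) ≤ (if p ∈ Finset.range M then 2 else 1) * (p : ℝ) ^ ε := by
    intro p hp
    have hp1 : (1 : ℝ) ≤ p := by
      exact_mod_cast (Nat.prime_of_mem_primeFactors hp).one_lt.le
    split_ifs with h
    · nlinarith [Real.one_le_rpow hp1 hε.le]
    · simp only [Finset.mem_range, not_lt] at h
      have : (2 : ℝ) ^ (1 / ε) ≤ p := hM.trans (by exact_mod_cast h)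
      have h4 := Real.rpow_le_rpow (by positivity) this hε.le
      rw [← Real.rpow_mul (by norm_num)] at h4
      simpa [hε.ne'] using h4
  calc ((2 ^ n.primeFactors.card : ℕ) : ℝ) = ∏ p ∈ n.primeFactors, (2 : ℝ) := by simp
    _ ≤ ∏ p ∈ n.primeFactors, ((if p ∈ Finset.range M then (2:ℝ) else 1) * (p : ℝ) ^ ε) :=
        Finset.prod_le_prod (fun _ _ => by norm_num) h3
    _ = (∏ p ∈ n.primeFactors, (if p ∈ Finset.range M then (2:ℝ) else 1)) * ∏ p ∈ n.primeFactors, (p : ℝ) ^ ε :=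
        Finset.prod_mul_distrib
    _ ≤ _ := by
        gcongr
        rw [Finset.prod_ite, Finset.prod_const, Finset.prod_const_one, mul_one]
        apply pow_le_pow_right₀ (by norm_num)
        calc _ ≤ (Finset.range M).card := Finset.card_le_card (fun a ha => by
              simp only [Finset.mem_filter] at ha; exact ha.2)
          _ = M := Finset.card_range M

lemma pell_fiber {α β : Type*} [DecidableEq β] (S : Finset α) (T : Finset β) (f : α → β) (k : ℝ)
    (hf : ∀ a ∈ S, f a ∈ T) (hk : ∀ b ∈ T, ((S.filter (fun a => f a = b)).card : ℝ) ≤ k) :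
    (S.card : ℝ) ≤ k * T.card := by
  rw [Finset.card_eq_sum_card_fiberwise (f := f) (t := T) hf]
  push_cast
  calc _ ≤ ∑ b ∈ T, k := Finset.sum_le_sum hk
    _ = _ := by simp [mul_comm]

lemma pell_floor {α : Type*} (S : Finset α) (f : α → ℝ) (M h : ℝ) (k : ℕ) (hh : 0 < h)
    (h0 : ∀ a ∈ S, 0 ≤ f a) (hM : ∀ a ∈ S, f a ≤ M) (hM0 : 0 ≤ M)
    (hk : ∀ T : Finset α, T ⊆ S → (∀ a ∈ T, ∀ b ∈ T, |f a - f b| < h) → T.card ≤ k) :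
    (S.card : ℝ) ≤ k * (M / h + 1) := by
  have h1 := pell_fiber S (Finset.range (⌊M / h⌋₊ + 1)) (fun a => ⌊f a / h⌋₊) k ?_ ?_
  · refine h1.trans ?_
    gcongr
    rw [Finset.card_range]
    push_cast
    gcongr
    exact Nat.floor_le (by positivity)
  · intro a ha
    rw [Finset.mem_range, Nat.lt_succ_iff]
    apply Nat.floor_le_floor
    gcongr
    exact hM a ha
  · intro b hb
    norm_cast
    apply hk _ (Finset.filter_subset _ _)
    have key : ∀ a ∈ S.filter (fun a => ⌊f a / h⌋₊ = b), b * h ≤ f a ∧ f a < (b + 1) * h := by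
      intro a ha
      rw [Finset.mem_filter] at ha
      have h2 := (Nat.floor_eq_iff (div_nonneg (h0 a ha.1) hh.le)).1 ha.2
      rw [le_div_iff₀ hh, div_lt_iff₀ hh] at h2
      exact h2
    intro a ha c hc
    have := key a ha
    have := key c hc
    rw [abs_lt]
    constructor <;> nlinarith

lemma pell_icc (X : ℝ) (hX : 1 / 2 ≤ X) : ((Finset.Icc ⌈X⌉ ⌊2 * X⌋).card : ℝ) ≤ 3 * X := by
  rw [Int.card_Icc]
  have : (((⌊2 * X⌋ + 1 - ⌈X⌉).toNat : ℤ) : ℝ) ≤ 3 * X := by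
    rw [Int.toNat_eq_max]
    push_cast
    apply max_le
    · linarith [Int.floor_le (2 * X), Int.le_ceil X]
    · linarith
  exact_mod_cast this

lemma pell_class (n y z y' z' y0 z0 : ℤ) (hn : Squarefree n) (hc : IsCoprime y0 z0)
    (h1 : n ∣ (y * z0 - y0 * z) * (y * z0 + y0 * z))
    (h2 : n ∣ (y' * z0 - y0 * z') * (y' * z0 + y0 * z'))
    (hg : Int.gcd n (y * z0 - y0 * z) = Int.gcd n (y' * z0 - y0 * z')) :
    n ∣ y * z' - y' * z := by
  have hn0 : n ≠ 0 := hn.ne_zero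
  set A := y * z0 - y0 * z with hA
  set A' := y' * z0 - y0 * z' with hA'
  obtain ⟨e, he⟩ : ∃ e : ℤ, e = Int.gcd n A := ⟨_, rfl⟩
  have he' : e = Int.gcd n A' := by rw [he, hg]
  have heA : e ∣ A := he ▸ Int.gcd_dvd_right ..
  have heA' : e ∣ A' := he' ▸ Int.gcd_dvd_right ..
  obtain ⟨f, hf⟩ : e ∣ n := he ▸ Int.gcd_dvd_left ..
  have he0 : e ≠ 0 := by rintro rfl; simp at hf; exact hn0 hf
  have gen : ∀ A B : ℤ, e = Int.gcd n A → n ∣ A * B → f ∣ B := by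
    intro A B h h'
    have hb := Int.gcd_eq_gcd_ab n A
    rw [← h] at hb
    have : e * f ∣ e * B := by
      rw [← hf]
      have : e * B = n * (Int.gcdA n A * B) + (A * B) * Int.gcdB n A := by
        conv_lhs => rw [hb]
        ring
      rw [this]
      exact dvd_add (dvd_mul_right _ _) (h'.mul_right _)
    exact (mul_dvd_mul_iff_left he0).1 this
  have hfB := gen _ _ he h1
  have hfB' := gen _ _ he' h2
  obtain ⟨u, v, huv⟩ := hc
  have e1 : e ∣ y * z' - y' * z := by
    obtain ⟨a, ha⟩ := heA
    obtain ⟨b, hb⟩ := heA'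
    refine ⟨v * (a * z' - b * z) + u * (a * y' - b * y), ?_⟩
    rw [hA] at ha; rw [hA'] at hb
    linear_combination (-(y * z' - y' * z)) * huv + (v * z' + u * y') * ha - (v * z + u * y) * hb
  have f1 : f ∣ y * z' - y' * z := by
    obtain ⟨a, ha⟩ := hfB
    obtain ⟨b, hb⟩ := hfB'
    refine ⟨v * (a * z' - b * z) + u * (-a * y' + b * y), ?_⟩
    linear_combination (-(y * z' - y' * z)) * huv + (v * z' - u * y') * ha - (v * z - u * y) * hb
  have : n ∣ (y * z' - y' * z) ^ 2 := by
    rw [hf, pow_two]; exact mul_dvd_mul e1 f1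
  exact (hn.dvd_pow_iff_dvd (by norm_num)).1 this

lemma pell_geom (p q c s X0 X1 X2 Y0 Y1 Y2 : ℝ) (hs : s = 1 ∨ s = -1) (hp : 0 < p) (hq : 0 < q)
    (hX0 : 0 < X0) (hX1 : 0 < X1) (hX2 : 0 < X2) (hY0 : 0 < Y0) (hY1 : 0 < Y1) (hY2 : 0 < Y2)
    (h0 : q * Y0 ^ 2 + s * (p * X0 ^ 2) = c) (h1 : q * Y1 ^ 2 + s * (p * X1 ^ 2) = c)
    (h2 : q * Y2 ^ 2 + s * (p * X2 ^ 2) = c)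
    (l0 : p * X0 ^ 2 < q * Y0 ^ 2) (l1 : p * X1 ^ 2 < q * Y1 ^ 2) (l2 : p * X2 ^ 2 < q * Y2 ^ 2)
    (n01 : X0 ≠ X1) (n02 : X0 ≠ X2) (n12 : X1 ≠ X2) (E : ℝ)
    (hE : E = (X1 - X0) * (Y2 - Y1) - (X2 - X1) * (Y1 - Y0)) :
    E ≠ 0 ∧ q * (Y1 + Y2) * |E| ≤ 2 * p * (|X0 - X1| * |X1 - X2| * |X0 - X2|) := by
  have mul : ∀ a b a' b' : ℝ, 0 < a → 0 < b → 0 < a' → 0 < b' → p * a ^ 2 < q * b ^ 2 →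
      p * a' ^ 2 < q * b' ^ 2 → p * (a * a') < q * (b * b') := by
    intro a b a' b' ha hb ha' hb' h h'
    have : (p * (a * a')) ^ 2 < (q * (b * b')) ^ 2 := by
      calc _ = (p * a ^ 2) * (p * a' ^ 2) := by ring
        _ < (q * b ^ 2) * (q * b' ^ 2) := by gcongr
        _ = _ := by ring
    exact lt_of_pow_lt_pow_left₀ 2 (by positivity) this
  have m01 := mul _ _ _ _ hX0 hY0 hX1 hY1 l0 l1
  have m02 := mul _ _ _ _ hX0 hY0 hX2 hY2 l0 l2
  have m12 := mul _ _ _ _ hX1 hY1 hX2 hY2 l1 l2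
  set U := q * ((Y0 + Y1) * (Y0 + Y2)) with hU
  set V := p * ((X0 + X1) * (X0 + X2)) with hV
  have hVU : V < U := by rw [hU, hV]; nlinarith
  have hV0 : 0 < V := by positivity
  have hU0 : 0 < U := by positivity
  have id : q * (Y1 + Y2) * E * U = -s * p * ((X1 - X0) * (X2 - X1) * (X2 - X0)) * (U + s * V) := by
    have a01 : q * (Y1 - Y0) * (Y1 + Y0) = -s * p * (X1 - X0) * (X1 + X0) := by
      linear_combination h1 - h0
    have a12 : q * (Y2 - Y1) * (Y2 + Y1) = -s * p * (X2 - X1) * (X2 + X1) := by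
      linear_combination h2 - h1
    have a02 : q * (Y2 - Y0) * (Y2 + Y0) = -s * p * (X2 - X0) * (X2 + X0) := by
      linear_combination h2 - h0
    have b : q * (Y1 + Y2) * (Y0 + Y1) * E = -s * p * (X1 - X0) * (X2 - X1) *
        ((X2 + X1) * (Y0 + Y1) - (X1 + X0) * (Y1 + Y2)) := by
      rw [hE]
      linear_combination (X1 - X0) * (Y0 + Y1) * a12 - (X2 - X1) * (Y1 + Y2) * a01
    rw [hU, hV]
    linear_combination q * (Y0 + Y2) * b - (-s * p * (X1 - X0) * (X2 - X1)) * (X0 + X1) * a02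
  have hUV : 0 < U + s * V ∧ U + s * V ≤ 2 * U := by
    rcases hs with rfl | rfl <;> constructor <;> linarith
  have hs0 : s ≠ 0 := by rcases hs with rfl | rfl <;> norm_num
  have hsa : |s| = 1 := by rcases hs with rfl | rfl <;> norm_num
  constructor
  · intro hE0
    have : -s * p * ((X1 - X0) * (X2 - X1) * (X2 - X0)) * (U + s * V) ≠ 0 := by
      have := sub_ne_zero.2 n01.symm
      have := sub_ne_zero.2 n02.symm
      have := sub_ne_zero.2 n12.symm
      exact mul_ne_zero (mul_ne_zero (mul_ne_zero (neg_ne_zero.2 hs0) hp.ne') (mul_ne_zero (mul_ne_zero ‹_› ‹_›) ‹_›)) hUV.1.ne'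
    apply this
    rw [← id, hE0]; ring
  · have h3 := congrArg abs id
    simp only [abs_mul, abs_neg, hsa, abs_of_pos hq, abs_of_pos hp, abs_of_pos hU0, abs_of_pos hUV.1,
      abs_of_pos (add_pos hY1 hY2)] at h3
    rw [abs_sub_comm X0, abs_sub_comm X1 X2, abs_sub_comm X0]
    have h4 : q * (Y1 + Y2) * |E| * U ≤ 2 * p * (|X1 - X0| * |X2 - X1| * |X2 - X0|) * U := by
      rw [h3]
      have : 0 ≤ p * (|X1 - X0| * |X2 - X1| * |X2 - X0|) := by positivity
      nlinarith [mul_le_mul_of_nonneg_left hUV.2 this]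
    exact le_of_mul_le_mul_right h4 hU0

/-- Part A: two solutions with the same `x, y, z`. -/
lemma pell_cross {σ κ p q r p' q' r' x y z : ℤ} (hσ : σ = 1 ∨ σ = -1) (hκ : 0 < κ)
    (h : PellSol σ κ p q r x y z) (h' : PellSol σ κ p' q' r' x y z)
    (hne : (p, q, r) ≠ (p', q', r')) :
    z ^ 2 ≤ |p * q' - p' * q| ∧ y ^ 2 ≤ |p * r' - p' * r| ∧ x ^ 2 ≤ |q * r' - q' * r| := by
  have cop : ∀ a b a' b' : ℤ, 0 < a → 0 < b → 0 < a' → 0 < b' → IsCoprime a b → IsCoprime a' b' →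
      a * b' - a' * b = 0 → a = a' ∧ b = b' := by
    intro a b a' b' ha hb ha' hb' c c' h
    have h1 : a ∣ a' := c.dvd_of_dvd_mul_right ⟨b', by linarith⟩
    have h2 : a' ∣ a := c'.dvd_of_dvd_mul_right ⟨b, by linarith⟩
    have h3 : a = a' := Int.dvd_antisymm ha.le ha'.le h1 h2
    subst h3
    refine ⟨rfl, ?_⟩
    have : a * (b' - b) = 0 := by linarith
    rcases mul_eq_zero.1 this with h | h <;> linarith
  have hx := h.hx
  have hy := h.hy
  have hz := h.hz
  have e := h.eq
  have e' := h'.eq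
  have hσ2 : σ * σ = 1 := by rcases hσ with rfl | rfl <;> norm_num
  have rr : p = p' → q = q' → r = r' := by
    rintro rfl rfl
    have : (κ * z ^ 2) * (r - r') = 0 := by linear_combination e' - e
    rcases mul_eq_zero.1 this with h | h
    · have : 0 < κ * z ^ 2 := by positivity
      omega
    · omega
  have pp : q = q' → r = r' → p = p' := by
    rintro rfl rfl
    have : (x ^ 2) * (p - p') = 0 := by
      linear_combination σ * e - σ * e' - x ^ 2 * (p - p') * hσ2
    rcases mul_eq_zero.1 this with h | h
    · have : 0 < x ^ 2 := by positivity
      omega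
    · omega
  have qq : p = p' → r = r' → q = q' := by
    rintro rfl rfl
    have : (y ^ 2) * (q - q') = 0 := by
      linear_combination e - e'
    rcases mul_eq_zero.1 this with h | h
    · have : 0 < y ^ 2 := by positivity
      omega
    · omega
  refine ⟨?_, ?_, ?_⟩
  · have hd : z ^ 2 ∣ p * q' - p' * q := by
      have : z ^ 2 ∣ y ^ 2 * (p * q' - p' * q) :=
        ⟨κ * (p * r' - p' * r), by linear_combination p * e' - p' * e⟩
      exact (h.cyz.symm.pow).dvd_of_dvd_mul_left this
    refine Int.le_of_dvd (abs_pos.2 fun h0 => hne ?_) ((dvd_abs _ _).2 hd)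
    obtain ⟨h1, h2⟩ := cop _ _ _ _ h.hp h.hq h'.hp h'.hq h.cpq h'.cpq h0
    rw [h1, h2, rr h1 h2]
  · have hd : y ^ 2 ∣ p * r' - p' * r := by
      have : y ^ 2 ∣ x ^ 2 * (p * r' - p' * r) :=
        ⟨σ * (r * q' - r' * q), by
          linear_combination σ * r' * e - σ * r * e' - x ^ 2 * (p * r' - p' * r) * hσ2⟩
      exact (h.cxy.symm.pow).dvd_of_dvd_mul_left this
    refine Int.le_of_dvd (abs_pos.2 fun h0 => hne ?_) ((dvd_abs _ _).2 hd)
    obtain ⟨h1, h2⟩ := cop _ _ _ _ h.hp h.hr h'.hp h'.hr h.cpr h'.cpr h0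
    rw [h1, h2, qq h1 h2]
  · have hd : x ^ 2 ∣ q * r' - q' * r := by
      have : x ^ 2 ∣ y ^ 2 * (q * r' - q' * r) :=
        ⟨σ * (r * p' - r' * p), by
          linear_combination r' * e - r * e'⟩
      exact (h.cxy.pow).dvd_of_dvd_mul_left this
    refine Int.le_of_dvd (abs_pos.2 fun h0 => hne ?_) ((dvd_abs _ _).2 hd)
    obtain ⟨h1, h2⟩ := cop _ _ _ _ h.hq h.hr h'.hq h'.hr h.cqr h'.cqr h0
    rw [h1, h2, pp h1 h2]

lemma pell_slope {α : Type*} (S : Finset α) (u v : α → ℤ) (U V Δ : ℝ) (hU : 0 < U) (hV : 0 < V)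
    (hΔ : 0 < Δ) (hu : ∀ a ∈ S, U ≤ u a ∧ (u a : ℝ) ≤ 2 * U)
    (hv : ∀ a ∈ S, V ≤ v a ∧ (v a : ℝ) ≤ 2 * V)
    (h : ∀ a ∈ S, ∀ b ∈ S, a ≠ b → Δ ≤ |(u a : ℝ) * v b - u b * v a|) :
    (S.card : ℝ) ≤ 1 + 8 * (U * V / Δ) := by
  have h1 := pell_floor S (fun a => (u a : ℝ) / v a) (2 * U / V) (Δ / (4 * V ^ 2)) 1 (by positivity)
    ?_ ?_ (by positivity) ?_
  · refine h1.trans (le_of_eq ?_)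
    field_simp
    ring
  · intro a ha
    have := hu a ha
    have := hv a ha
    exact div_nonneg (by linarith) (by linarith)
  · intro a ha
    obtain ⟨h2, h3⟩ := hu a ha
    obtain ⟨h4, h5⟩ := hv a ha
    show (u a : ℝ) / v a ≤ _
    gcongr
  · intro T hT hd
    rw [Finset.card_le_one]
    intro a ha b hb
    by_contra hab
    have h2 := h a (hT ha) b (hT hb) hab
    have h3 := hd a ha b hb
    obtain ⟨h4, h5⟩ := hv a (hT ha)
    obtain ⟨h6, h7⟩ := hv b (hT hb)
    have va : (0 : ℝ) < v a := by linarith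
    have vb : (0 : ℝ) < v b := by linarith
    rw [div_sub_div _ _ va.ne' vb.ne', abs_div, abs_of_pos (mul_pos va vb), div_lt_div_iff₀ (by positivity) (by positivity)] at h3
    have h8 : (v a : ℝ) * v b ≤ 4 * V ^ 2 := by nlinarith
    have h9 : |(u a : ℝ) * v b - v a * u b| = |(u a : ℝ) * v b - u b * v a| := by
      rw [mul_comm (v a : ℝ)]
    rw [h9] at h3
    have : Δ * (v a * v b) ≤ |(u a : ℝ) * v b - u b * v a| * (4 * V ^ 2) := by gcongr
    linarith

lemma pell_A (σ κ : ℤ) (hσ : σ = 1 ∨ σ = -1) (hκ : 0 < κ) (P Q R X Y Z : ℝ)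
    (hP : 0 < P) (hQ : 0 < Q) (hR : 0 < R) (hX : 0 < X) (hY : 0 < Y) (hZ : 0 < Z)
    (x y z : ℤ) (S : Finset (ℤ × ℤ × ℤ))
    (hS : ∀ t ∈ S, PellSol σ κ t.1 t.2.1 t.2.2 x y z ∧ PellBox P Q R X Y Z t.1 t.2.1 t.2.2 x y z) :
    (S.card : ℝ) ≤ 1 + 8 * (P * Q * R / (X * Y * Z)) ^ ((2 : ℝ) / 3) := by
  have cast : ∀ (W : ℝ) (w a : ℤ), 0 < W → W ≤ w → w ^ 2 ≤ |a| → W ^ 2 ≤ |(a : ℝ)| := by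
    intro W w a h0 h1 h2
    have : ((w : ℝ)) ^ 2 ≤ |(a : ℝ)| := by exact_mod_cast h2
    exact (by gcongr : W ^ 2 ≤ (w : ℝ) ^ 2).trans this
  have a1 := pell_slope S (fun t => t.1) (fun t => t.2.1) P Q (Z ^ 2) hP hQ (by positivity)
    (fun t ht => ⟨(hS t ht).2.p1, (hS t ht).2.p2⟩) (fun t ht => ⟨(hS t ht).2.q1, (hS t ht).2.q2⟩) (by
      intro t ht s hs hne
      have := cast Z z _ hZ (hS t ht).2.z1 (pell_cross hσ hκ (hS t ht).1 (hS s hs).1 hne).1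
      push_cast at this
      exact this)
  have a2 := pell_slope S (fun t => t.1) (fun t => t.2.2) P R (Y ^ 2) hP hR (by positivity)
    (fun t ht => ⟨(hS t ht).2.p1, (hS t ht).2.p2⟩) (fun t ht => ⟨(hS t ht).2.r1, (hS t ht).2.r2⟩) (by
      intro t ht s hs hne
      have := cast Y y _ hY (hS t ht).2.y1 (pell_cross hσ hκ (hS t ht).1 (hS s hs).1 hne).2.1
      push_cast at this
      exact this)
  have a3 := pell_slope S (fun t => t.2.1) (fun t => t.2.2) Q R (X ^ 2) hQ hR (by positivity)
    (fun t ht => ⟨(hS t ht).2.q1, (hS t ht).2.q2⟩) (fun t ht => ⟨(hS t ht).2.r1, (hS t ht).2.r2⟩) (by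
      intro t ht s hs hne
      have := cast X x _ hX (hS t ht).2.x1 (pell_cross hσ hκ (hS t ht).1 (hS s hs).1 hne).2.2
      push_cast at this
      exact this)
  set w := (P * Q * R / (X * Y * Z)) ^ ((2 : ℝ) / 3) with hw
  have hw0 : 0 < w := by positivity
  have hw3 : w ^ 3 = (P * Q / Z ^ 2) * (P * R / Y ^ 2) * (Q * R / X ^ 2) := by
    rw [hw, ← Real.rpow_natCast, ← Real.rpow_mul (by positivity)]
    norm_num
    field_simp
  by_contra hlt
  push Not at hlt
  have b1 : w < P * Q / Z ^ 2 := by linarith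
  have b2 : w < P * R / Y ^ 2 := by linarith
  have b3 : w < Q * R / X ^ 2 := by linarith
  have : w ^ 3 < (P * Q / Z ^ 2) * (P * R / Y ^ 2) * (Q * R / X ^ 2) := by
    calc w ^ 3 = w * w * w := by ring
      _ < _ := by gcongr
  linarith

/-- three solutions with the same coefficients in the same class -/
lemma pell_det {σ κ p q r x0 y0 z0 x1 y1 z1 x2 y2 z2 : ℤ} (hσ : σ = 1 ∨ σ = -1)
    (s0 : PellSol σ κ p q r x0 y0 z0) (s1 : PellSol σ κ p q r x1 y1 z1)
    (s2 : PellSol σ κ p q r x2 y2 z2)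
    (n01 : (x0, y0, z0) ≠ (x1, y1, z1)) (n02 : (x0, y0, z0) ≠ (x2, y2, z2))
    (n12 : (x1, y1, z1) ≠ (x2, y2, z2))
    (r01 : r ∣ x0 * y1 - x1 * y0) (r02 : r ∣ x0 * y2 - x2 * y0) (r12 : r ∣ x1 * y2 - x2 * y1)
    (q01 : q ∣ x0 * z1 - x1 * z0) (q02 : q ∣ x0 * z2 - x2 * z0) (q12 : q ∣ x1 * z2 - x2 * z1)
    (p01 : p ∣ y0 * z1 - y1 * z0) (p02 : p ∣ y0 * z2 - y2 * z0) (p12 : p ∣ y1 * z2 - y2 * z1)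
    (Y Z h : ℝ) (hY : 0 < Y) (hZ : 0 < Z) (hh : 0 < h)
    (bz0 : (z0 : ℝ) ≤ 2 * Z) (bz1 : (z1 : ℝ) ≤ 2 * Z) (bz2 : (z2 : ℝ) ≤ 2 * Z)
    (by1 : Y ≤ y1) (by2 : Y ≤ y2)
    (d01 : |(x0 : ℝ) / z0 - x1 / z1| < h) (d12 : |(x1 : ℝ) / z1 - x2 / z2| < h)
    (d02 : |(x0 : ℝ) / z0 - x2 / z2| < h) :
    (q : ℝ) ^ 2 * r * Y < 16 * Z ^ 4 * h ^ 3 := by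
  have hp : (0 : ℝ) < p := by exact_mod_cast s0.hp
  have hq : (0 : ℝ) < q := by exact_mod_cast s0.hq
  have hr : (0 : ℝ) < r := by exact_mod_cast s0.hr
  have hx0 : (0 : ℝ) < x0 := by exact_mod_cast s0.hx
  have hy0 : (0 : ℝ) < y0 := by exact_mod_cast s0.hy
  have hz0 : (0 : ℝ) < z0 := by exact_mod_cast s0.hz
  have hx1 : (0 : ℝ) < x1 := by exact_mod_cast s1.hx
  have hy1 : (0 : ℝ) < y1 := by exact_mod_cast s1.hy
  have hz1 : (0 : ℝ) < z1 := by exact_mod_cast s1.hz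
  have hx2 : (0 : ℝ) < x2 := by exact_mod_cast s2.hx
  have hy2 : (0 : ℝ) < y2 := by exact_mod_cast s2.hy
  have hz2 : (0 : ℝ) < z2 := by exact_mod_cast s2.hz
  have conic : ∀ x y z : ℤ, PellSol σ κ p q r x y z →
      (q : ℝ) * ((y : ℝ) / z) ^ 2 + σ * (p * ((x : ℝ) / z) ^ 2) = κ * r := by
    intro x y z s
    have hz : (0 : ℝ) < z := by exact_mod_cast s.hz
    have e : (q : ℝ) * y ^ 2 + σ * (p * x ^ 2) = κ * (r * z ^ 2) := by exact_mod_cast s.eq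
    field_simp
    linarith
  have clt : ∀ x y z : ℤ, PellSol σ κ p q r x y z →
      (p : ℝ) * ((x : ℝ) / z) ^ 2 < q * ((y : ℝ) / z) ^ 2 := by
    intro x y z s
    have hz : (0 : ℝ) < z := by exact_mod_cast s.hz
    have e : (p : ℝ) * x ^ 2 < q * y ^ 2 := by exact_mod_cast s.lt
    rw [div_pow, div_pow, ← mul_div_assoc, ← mul_div_assoc]
    gcongr
  have ne : ∀ x y z x' y' z' : ℤ, PellSol σ κ p q r x y z → PellSol σ κ p q r x' y' z' →
      (x, y, z) ≠ (x', y', z') → (x : ℝ) / z ≠ x' / z' := by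
    intro x y z x' y' z' s s' hne h
    have hz : (0 : ℝ) < z := by exact_mod_cast s.hz
    have hz' : (0 : ℝ) < z' := by exact_mod_cast s'.hz
    rw [div_eq_div_iff hz.ne' hz'.ne'] at h
    have h : x * z' = x' * z := by exact_mod_cast h
    have h1 : x ∣ x' := s.cxz.dvd_of_dvd_mul_right ⟨z', h.symm⟩
    have h2 : x' ∣ x := s'.cxz.dvd_of_dvd_mul_right ⟨z, h⟩
    have h3 : x = x' := Int.dvd_antisymm s.hx.le s'.hx.le h1 h2
    subst h3
    have h4 : z' = z := mul_left_cancel₀ s.hx.ne' h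
    subst h4
    have h5 : q * y ^ 2 = q * y' ^ 2 := by linarith [s.eq, s'.eq]
    have h6 : y ^ 2 = y' ^ 2 := mul_left_cancel₀ s.hq.ne' h5
    have h7 : y = y' := (pow_left_inj₀ s.hy.le s'.hy.le (by norm_num)).1 h6
    subst h7
    exact hne rfl
  have hσ' : (σ : ℝ) = 1 ∨ (σ : ℝ) = -1 := by
    rcases hσ with rfl | rfl <;> simp
  obtain ⟨g1, g2⟩ := pell_geom p q (κ * r) σ (x0 / z0) (x1 / z1) (x2 / z2) (y0 / z0) (y1 / z1) (y2 / z2)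
    hσ' hp hq (by positivity) (by positivity) (by positivity) (by positivity) (by positivity)
    (by positivity) (conic _ _ _ s0) (conic _ _ _ s1) (conic _ _ _ s2) (clt _ _ _ s0)
    (clt _ _ _ s1) (clt _ _ _ s2) (ne _ _ _ _ _ _ s0 s1 n01) (ne _ _ _ _ _ _ s0 s2 n02)
    (ne _ _ _ _ _ _ s1 s2 n12) _ rfl
  set E : ℝ := ((x1 : ℝ) / z1 - x0 / z0) * (y2 / z2 - y1 / z1) - (x2 / z2 - x1 / z1) * (y1 / z1 - y0 / z0) with hE
  obtain ⟨d, hd⟩ : ∃ d : ℤ, d = x0 * (y1 * z2 - y2 * z1) - x1 * (y0 * z2 - y2 * z0) + x2 * (y0 * z1 - y1 * z0) := ⟨_, rfl⟩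
  have hdE : (d : ℝ) = z0 * z1 * z2 * E := by
    rw [hd, hE]
    push_cast
    field_simp
    ring
  have hd0 : d ≠ 0 := by
    intro h0
    rw [h0] at hdE
    have : (z0 : ℝ) * z1 * z2 * E ≠ 0 := mul_ne_zero (by positivity) g1
    apply this
    rw [← hdE]; simp
  have dp : p ∣ d := by
    rw [hd]
    exact dvd_add (dvd_sub (p12.mul_left _) (p02.mul_left _)) (p01.mul_left _)
  have dq : q ∣ d := by
    have : d = -(y0 * (x1 * z2 - x2 * z1)) + y1 * (x0 * z2 - x2 * z0) - y2 * (x0 * z1 - x1 * z0) := by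
      rw [hd]; ring
    rw [this]
    exact dvd_sub (dvd_add ((q12.mul_left _).neg_right) (q02.mul_left _)) (q01.mul_left _)
  have dr : r ∣ d := by
    have : d = z0 * (x1 * y2 - x2 * y1) - z1 * (x0 * y2 - x2 * y0) + z2 * (x0 * y1 - x1 * y0) := by
      rw [hd]; ring
    rw [this]
    exact dvd_add (dvd_sub (r12.mul_left _) (r02.mul_left _)) (r01.mul_left _)
  have dpqr : p * q * r ∣ d :=
    (s0.cpr.mul_left s0.cqr).mul_dvd (s0.cpq.mul_dvd dp dq) dr
  have hle : p * q * r ≤ |d| := Int.le_of_dvd (abs_pos.2 hd0) ((dvd_abs _ _).2 dpqr)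
  have hle' : (p : ℝ) * q * r ≤ |(d : ℝ)| := by exact_mod_cast hle
  rw [hdE, abs_mul, abs_of_pos (by positivity)] at hle'
  have hzz : (z0 : ℝ) * z1 * z2 ≤ (2 * Z) * (2 * Z) * (2 * Z) := by gcongr
  have hle2 : (p : ℝ) * q * r ≤ 8 * Z ^ 3 * |E| := by
    refine hle'.trans ?_
    calc _ ≤ (2 * Z) * (2 * Z) * (2 * Z) * |E| := by gcongr
      _ = _ := by ring
  have hYZ : Y / Z ≤ (y1 : ℝ) / z1 + y2 / z2 := by
    have a1 : Y / (2 * Z) ≤ (y1 : ℝ) / z1 := by gcongr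
    have a2 : Y / (2 * Z) ≤ (y2 : ℝ) / z2 := by gcongr
    have : Y / Z = Y / (2 * Z) + Y / (2 * Z) := by field_simp; ring
    linarith
  have hprod : |(x0 : ℝ) / z0 - x1 / z1| * |(x1 : ℝ) / z1 - x2 / z2| * |(x0 : ℝ) / z0 - x2 / z2| < h ^ 3 := by
    calc _ < h * h * h := by gcongr
      _ = _ := by ring
  have f1 : (p : ℝ) * q * r * (q * (Y / Z)) < 8 * Z ^ 3 * (2 * p * h ^ 3) := by
    calc _ ≤ 8 * Z ^ 3 * |E| * (q * ((y1 : ℝ) / z1 + y2 / z2)) := by gcongr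
      _ = 8 * Z ^ 3 * (q * ((y1 : ℝ) / z1 + y2 / z2) * |E|) := by ring
      _ ≤ 8 * Z ^ 3 * (2 * p * (|(x0 : ℝ) / z0 - x1 / z1| * |(x1 : ℝ) / z1 - x2 / z2| * |(x0 : ℝ) / z0 - x2 / z2|)) := by gcongr
      _ < _ := by gcongr
  have f2 : p / Z * ((q : ℝ) ^ 2 * r * Y) < p / Z * (16 * Z ^ 4 * h ^ 3) := by
    calc _ = (p : ℝ) * q * r * (q * (Y / Z)) := by field_simp
      _ < _ := f1
      _ = _ := by field_simp; ring
  exact lt_of_mul_lt_mul_left f2 (by positivity)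

lemma pell_B (σ κ : ℤ) (hσ : σ = 1 ∨ σ = -1) (P Q R X Y Z : ℝ)
    (hP : 0 < P) (hQ : 0 < Q) (hR : 0 < R) (hX : 0 < X) (hY : 0 < Y) (hZ : 0 < Z)
    (hbig : P * Q * R ≤ X * Y * Z)
    (p q r : ℤ) (S : Finset (ℤ × ℤ × ℤ))
    (hS : ∀ t ∈ S, PellSol σ κ p q r t.1 t.2.1 t.2.2 ∧ PellBox P Q R X Y Z p q r t.1 t.2.1 t.2.2) :
    (S.card : ℝ) ≤ 18 * (X * Y * Z / (P * Q * R)) ^ ((1 : ℝ) / 3) *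
      (p.natAbs.divisors.card * q.natAbs.divisors.card * r.natAbs.divisors.card) := by
  classical
  rcases S.eq_empty_or_nonempty with rfl | ⟨⟨x0, y0, z0⟩, h0⟩
  · simp only [Finset.card_empty, Nat.cast_zero]; positivity
  obtain ⟨s0, b0⟩ := hS _ h0
  simp only at s0 b0
  have hp : (0 : ℝ) < p := by exact_mod_cast s0.hp
  have hq : (0 : ℝ) < q := by exact_mod_cast s0.hq
  have hr : (0 : ℝ) < r := by exact_mod_cast s0.hr
  set t := (X * Y * Z / (P * Q * R)) ^ ((1 : ℝ) / 3) with ht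
  have ht1 : 1 ≤ t := by
    apply Real.one_le_rpow _ (by norm_num)
    rw [one_le_div (by positivity)]; exact hbig
  have ht3 : t ^ 3 = X * Y * Z / (P * Q * R) := by
    rw [ht, ← Real.rpow_natCast, ← Real.rpow_mul (by positivity)]
    norm_num
  -- divisibility of differences of squares
  have dr : ∀ x y z x' y' z', PellSol σ κ p q r x y z → PellSol σ κ p q r x' y' z' →
      r ∣ (x * y' - x' * y) * (x * y' + x' * y) := by
    intro x y z x' y' z' s s'
    apply s.cpr.symm.dvd_of_dvd_mul_left
    have hσ2 : σ * σ = 1 := by rcases hσ with rfl | rfl <;> norm_num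
    refine ⟨σ * κ * (z ^ 2 * y' ^ 2 - z' ^ 2 * y ^ 2), ?_⟩
    linear_combination σ * y' ^ 2 * s.eq - σ * y ^ 2 * s'.eq - p * (x^2 * y'^2 - x'^2 * y^2) * hσ2
  have dq : ∀ x y z x' y' z', PellSol σ κ p q r x y z → PellSol σ κ p q r x' y' z' →
      q ∣ (x * z' - x' * z) * (x * z' + x' * z) := by
    intro x y z x' y' z' s s'
    apply s.cpq.symm.dvd_of_dvd_mul_left
    have hσ2 : σ * σ = 1 := by rcases hσ with rfl | rfl <;> norm_num
    refine ⟨σ * (z ^ 2 * y' ^ 2 - z' ^ 2 * y ^ 2), ?_⟩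
    linear_combination σ * z' ^ 2 * s.eq - σ * z ^ 2 * s'.eq - p * (x^2 * z'^2 - x'^2 * z^2) * hσ2
  have dp : ∀ x y z x' y' z', PellSol σ κ p q r x y z → PellSol σ κ p q r x' y' z' →
      p ∣ (y * z' - y' * z) * (y * z' + y' * z) := by
    intro x y z x' y' z' s s'
    apply s.cpq.dvd_of_dvd_mul_left
    refine ⟨σ * (x' ^ 2 * z ^ 2 - x ^ 2 * z' ^ 2), ?_⟩
    linear_combination z' ^ 2 * s.eq - z ^ 2 * s'.eq
  have key := pell_fiber S
    (p.natAbs.divisors ×ˢ q.natAbs.divisors ×ˢ r.natAbs.divisors)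
    (fun w => (Int.gcd p (w.2.1 * z0 - y0 * w.2.2), Int.gcd q (w.1 * z0 - x0 * w.2.2),
      Int.gcd r (w.1 * y0 - x0 * w.2.1))) (18 * t) ?_ ?_
  · rw [Finset.card_product, Finset.card_product] at key
    push_cast at key
    rw [mul_assoc (p.natAbs.divisors.card : ℝ)]
    exact key
  · intro w hw
    simp only [Finset.mem_product, Nat.mem_divisors]
    refine ⟨⟨Nat.gcd_dvd_left _ _, ?_⟩, ⟨Nat.gcd_dvd_left _ _, ?_⟩, ⟨Nat.gcd_dvd_left _ _, ?_⟩⟩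
    · exact Int.natAbs_ne_zero.2 s0.hp.ne'
    · exact Int.natAbs_ne_zero.2 s0.hq.ne'
    · exact Int.natAbs_ne_zero.2 s0.hr.ne'
  rintro ⟨g1, g2, g3⟩ -
  set T := S.filter (fun w => (Int.gcd p (w.2.1 * z0 - y0 * w.2.2), Int.gcd q (w.1 * z0 - x0 * w.2.2),
      Int.gcd r (w.1 * y0 - x0 * w.2.1)) = (g1, g2, g3)) with hT
  have cls : ∀ a ∈ T, ∀ b ∈ T, r ∣ a.1 * b.2.1 - b.1 * a.2.1 ∧ q ∣ a.1 * b.2.2 - b.1 * a.2.2 ∧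
      p ∣ a.2.1 * b.2.2 - b.2.1 * a.2.2 := by
    intro a ha b hb
    rw [hT, Finset.mem_filter] at ha hb
    obtain ⟨ha, ha'⟩ := ha
    obtain ⟨hb, hb'⟩ := hb
    simp only [Prod.mk.injEq] at ha' hb'
    have sa := (hS a ha).1
    have sb := (hS b hb).1
    exact ⟨pell_class r _ _ _ _ x0 y0 s0.sr s0.cxy (dr _ _ _ _ _ _ sa s0) (dr _ _ _ _ _ _ sb s0) (by rw [ha'.2.2, hb'.2.2]),
      pell_class q _ _ _ _ x0 z0 s0.sq s0.cxz (dq _ _ _ _ _ _ sa s0) (dq _ _ _ _ _ _ sb s0) (by rw [ha'.2.1, hb'.2.1]),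
      pell_class p _ _ _ _ y0 z0 s0.sp s0.cyz (dp _ _ _ _ _ _ sa s0) (dp _ _ _ _ _ _ sb s0) (by rw [ha'.1, hb'.1])⟩
  have hTS : T ⊆ S := Finset.filter_subset _ _
  set h := ((q : ℝ) ^ 2 * r * Y / (16 * Z ^ 4)) ^ ((1 : ℝ) / 3) with hh
  have hh0 : 0 < h := by positivity
  have hh3 : h ^ 3 = (q : ℝ) ^ 2 * r * Y / (16 * Z ^ 4) := by
    rw [hh, ← Real.rpow_natCast, ← Real.rpow_mul (by positivity)]
    norm_num
  have fl := pell_floor T (fun w => (w.1 : ℝ) / w.2.2) (2 * X / Z) h 2 hh0 ?_ ?_ (by positivity) ?_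
  · refine fl.trans ?_
    have : X / (Z * h) ≤ 4 * t := by
      have : (X / (Z * h)) ^ 3 ≤ (4 * t) ^ 3 := by
        rw [div_pow, mul_pow, mul_pow, hh3, ht3]
        have e1 : (p : ℝ) * X ^ 2 ≤ 4 * q * Y ^ 2 := by
          have l : (p : ℝ) * x0 ^ 2 < q * y0 ^ 2 := by exact_mod_cast s0.lt
          have l1 : X ^ 2 ≤ (x0 : ℝ) ^ 2 := by gcongr; exact b0.x1
          have hy0 : (0 : ℝ) < y0 := by exact_mod_cast s0.hy
          have l2 : (y0 : ℝ) ^ 2 ≤ (2 * Y) ^ 2 := by gcongr; exact b0.y2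
          nlinarith
        have e2 : P * Q * R ≤ (p : ℝ) * q * r := by
          gcongr
          · exact b0.p1
          · exact b0.q1
          · exact b0.r1
        calc X ^ 3 / (Z ^ 3 * ((q : ℝ) ^ 2 * r * Y / (16 * Z ^ 4)))
            = (p * X ^ 2) * (16 * X * Z / (p * q ^ 2 * r * Y)) := by field_simp
          _ ≤ (4 * q * Y ^ 2) * (16 * X * Z / (p * q ^ 2 * r * Y)) := by gcongr
          _ = 64 * (X * Y * Z / ((p : ℝ) * q * r)) := by field_simp; ring
          _ ≤ 64 * (X * Y * Z / (P * Q * R)) := by gcongr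
          _ = _ := by norm_num
      exact le_of_pow_le_pow_left₀ (by norm_num) (by positivity) this
    have e : 2 * X / Z / h = 2 * (X / (Z * h)) := by field_simp
    rw [e]
    push_cast
    linarith
  · intro a ha
    have s := (hS a (hTS ha)).1
    have := s.hx
    have := s.hz
    positivity
  · intro a ha
    have b := (hS a (hTS ha)).2
    show (a.1 : ℝ) / a.2.2 ≤ _
    have := b.z1
    have := b.x2
    gcongr
  · intro U hU hd
    by_contra hlt
    push Not at hlt
    obtain ⟨a, ha, b, hb, c, hc, hab, hac, hbc⟩ := Finset.two_lt_card.1 hlt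
    have sa := hS a (hTS (hU ha))
    have sb := hS b (hTS (hU hb))
    have sc := hS c (hTS (hU hc))
    have ab := cls a (hU ha) b (hU hb)
    have ac := cls a (hU ha) c (hU hc)
    have bc := cls b (hU hb) c (hU hc)
    have := pell_det hσ sa.1 sb.1 sc.1 hab hac hbc ab.1 ac.1 bc.1 ab.2.1 ac.2.1 bc.2.1 ab.2.2
      ac.2.2 bc.2.2 Y Z h hY hZ hh0 sa.2.z2 sb.2.z2 sc.2.z2 sb.2.y1 sc.2.y1 (hd a ha b hb)
      (hd b hb c hc) (hd a ha c hc)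
    rw [hh3] at this
    have e : 16 * Z ^ 4 * ((q : ℝ) ^ 2 * r * Y / (16 * Z ^ 4)) = (q : ℝ) ^ 2 * r * Y := by field_simp
    linarith

lemma pell_icc3 (X Y Z : ℝ) (hX : 1 / 2 ≤ X) (hY : 1 / 2 ≤ Y) (hZ : 1 / 2 ≤ Z) :
    ((Finset.Icc ⌈X⌉ ⌊2 * X⌋ ×ˢ Finset.Icc ⌈Y⌉ ⌊2 * Y⌋ ×ˢ Finset.Icc ⌈Z⌉ ⌊2 * Z⌋).card : ℝ) ≤
      27 * (X * Y * Z) := by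
  rw [Finset.card_product, Finset.card_product]
  push_cast
  calc _ ≤ (3 * X) * ((3 * Y) * (3 * Z)) := by
        gcongr
        · exact pell_icc X hX
        · exact pell_icc Y hY
        · exact pell_icc Z hZ
    _ = _ := by ring

lemma pell_T (ε : ℝ) (hε : 0 < ε) : ∃ C : ℝ, 0 < C ∧ ∀ (σ κ : ℤ) (P Q R X Y Z : ℝ),
    (σ = 1 ∨ σ = -1) → 0 < κ → 1 / 2 ≤ P → 1 / 2 ≤ Q → 1 / 2 ≤ R → 1 / 2 ≤ X → 1 / 2 ≤ Y →
    1 / 2 ≤ Z → ∀ S : Finset ((ℤ × ℤ × ℤ) × (ℤ × ℤ × ℤ)),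
    (∀ t ∈ S, PellSol σ κ t.1.1 t.1.2.1 t.1.2.2 t.2.1 t.2.2.1 t.2.2.2 ∧
      PellBox P Q R X Y Z t.1.1 t.1.2.1 t.1.2.2 t.2.1 t.2.2.1 t.2.2.2) →
    (S.card : ℝ) ≤ C * (P * Q * R) ^ ((2 : ℝ) / 3 + ε) * (X * Y * Z) ^ ((1 : ℝ) / 3) := by
  classical
  obtain ⟨c, hc1, hc⟩ := pell_tau ε hε
  refine ⟨486 * c ^ 3 * 8 ^ ε, by positivity, ?_⟩
  intro σ κ P Q R X Y Z hσ hκ hP hQ hR hX hY hZ S hS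
  have hP0 : 0 < P := by linarith
  have hQ0 : 0 < Q := by linarith
  have hR0 : 0 < R := by linarith
  have hX0 : 0 < X := by linarith
  have hY0 : 0 < Y := by linarith
  have hZ0 : 0 < Z := by linarith
  obtain ⟨a, ha⟩ : ∃ a, a = P * Q * R := ⟨_, rfl⟩
  obtain ⟨b, hb⟩ : ∃ b, b = X * Y * Z := ⟨_, rfl⟩
  have ha0 : 0 < a := by rw [ha]; positivity
  have hb0 : 0 < b := by rw [hb]; positivity
  have ha8 : 1 ≤ 8 * a := by
    have : (1 / 2) * (1 / 2) * (1 / 2) ≤ P * Q * R := by gcongr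
    rw [ha]; linarith
  have hc3 : 1 ≤ c ^ 3 := one_le_pow₀ hc1
  have h8 : (8 : ℝ) ^ ε * a ^ ε = (8 * a) ^ ε := (Real.mul_rpow (by norm_num) ha0.le).symm
  have h81 : 1 ≤ (8 * a) ^ ε := Real.one_le_rpow ha8 hε.le
  rw [← ha, ← hb, Real.rpow_add ha0]
  rcases le_total b a with hab | hab
  · have key := pell_fiber S
      (Finset.Icc ⌈X⌉ ⌊2 * X⌋ ×ˢ Finset.Icc ⌈Y⌉ ⌊2 * Y⌋ ×ˢ Finset.Icc ⌈Z⌉ ⌊2 * Z⌋)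
      (fun t => t.2) (9 * (a / b) ^ ((2 : ℝ) / 3)) ?_ ?_
    · have hab1 : b * (a / b) ^ ((2 : ℝ) / 3) = a ^ ((2 : ℝ) / 3) * b ^ ((1 : ℝ) / 3) := by
        have : b = b ^ ((2 : ℝ) / 3) * b ^ ((1 : ℝ) / 3) := by
          rw [← Real.rpow_add hb0]; norm_num
        rw [Real.div_rpow ha0.le hb0.le]
        nth_rw 1 [this]
        field_simp
      calc (S.card : ℝ) ≤ _ := key
        _ ≤ 9 * (a / b) ^ ((2 : ℝ) / 3) * (27 * b) := by
          gcongr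
          rw [hb]
          exact pell_icc3 X Y Z hX hY hZ
        _ = 243 * (a ^ ((2 : ℝ) / 3) * b ^ ((1 : ℝ) / 3)) := by rw [← hab1]; ring
        _ ≤ (486 * c ^ 3 * (8 * a) ^ ε) * (a ^ ((2 : ℝ) / 3) * b ^ ((1 : ℝ) / 3)) := by
          gcongr
          nlinarith
        _ = _ := by rw [← h8]; ring
    · intro t ht
      have := (hS t ht).2
      simp only [Finset.mem_product, Finset.mem_Icc, Int.ceil_le, Int.le_floor]
      exact ⟨⟨this.x1, this.x2⟩, ⟨this.y1, this.y2⟩, ⟨this.z1, this.z2⟩⟩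
    · rintro ⟨x, y, z⟩ -
      have e : (S.filter (fun t => t.2 = (x, y, z))).card =
          ((S.filter (fun t => t.2 = (x, y, z))).image Prod.fst).card := by
        rw [Finset.card_image_of_injOn]
        intro s hs t ht h
        simp only [Finset.coe_filter, Set.mem_ofPred_eq] at hs ht
        exact Prod.ext h (hs.2.trans ht.2.symm)
      rw [e]
      refine (pell_A σ κ hσ hκ P Q R X Y Z hP0 hQ0 hR0 hX0 hY0 hZ0 x y z _ ?_).trans ?_
      · intro t ht
        simp only [Finset.mem_image, Finset.mem_filter] at ht
        obtain ⟨s, ⟨hs, hs'⟩, rfl⟩ := ht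
        have := hS s hs
        rw [hs'] at this
        exact this
      · rw [← ha, ← hb]
        have : 1 ≤ (a / b) ^ ((2 : ℝ) / 3) :=
          Real.one_le_rpow ((one_le_div hb0).2 hab) (by norm_num)
        linarith
  · have key := pell_fiber S
      (Finset.Icc ⌈P⌉ ⌊2 * P⌋ ×ˢ Finset.Icc ⌈Q⌉ ⌊2 * Q⌋ ×ˢ Finset.Icc ⌈R⌉ ⌊2 * R⌋)
      (fun t => t.1) (18 * (b / a) ^ ((1 : ℝ) / 3) * (c ^ 3 * (8 * a) ^ ε)) ?_ ?_
    · have hab1 : a * (b / a) ^ ((1 : ℝ) / 3) = a ^ ((2 : ℝ) / 3) * b ^ ((1 : ℝ) / 3) := by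
        have : a = a ^ ((2 : ℝ) / 3) * a ^ ((1 : ℝ) / 3) := by
          rw [← Real.rpow_add ha0]; norm_num
        rw [Real.div_rpow hb0.le ha0.le]
        nth_rw 1 [this]
        field_simp
      calc (S.card : ℝ) ≤ _ := key
        _ ≤ 18 * (b / a) ^ ((1 : ℝ) / 3) * (c ^ 3 * (8 * a) ^ ε) * (27 * a) := by
          gcongr
          rw [ha]
          exact pell_icc3 P Q R hP hQ hR
        _ = (486 * c ^ 3 * (8 * a) ^ ε) * (a ^ ((2 : ℝ) / 3) * b ^ ((1 : ℝ) / 3)) := by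
          rw [← hab1]; ring
        _ = _ := by rw [← h8]; ring
    · intro t ht
      have := (hS t ht).2
      simp only [Finset.mem_product, Finset.mem_Icc, Int.ceil_le, Int.le_floor]
      exact ⟨⟨this.p1, this.p2⟩, ⟨this.q1, this.q2⟩, ⟨this.r1, this.r2⟩⟩
    · rintro ⟨p, q, r⟩ -
      rcases (S.filter (fun t => t.1 = (p, q, r))).eq_empty_or_nonempty with h0 | ⟨t0, ht0⟩
      · rw [h0]; simp only [Finset.card_empty, Nat.cast_zero]; positivity
      have e : (S.filter (fun t => t.1 = (p, q, r))).card =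
          ((S.filter (fun t => t.1 = (p, q, r))).image Prod.snd).card := by
        rw [Finset.card_image_of_injOn]
        intro s hs t ht h
        simp only [Finset.coe_filter, Set.mem_ofPred_eq] at hs ht
        exact Prod.ext (hs.2.trans ht.2.symm) h
      rw [e]
      refine (pell_B σ κ hσ P Q R X Y Z hP0 hQ0 hR0 hX0 hY0 hZ0 (by rw [← ha, ← hb]; exact hab)
        p q r _ ?_).trans ?_
      · intro t ht
        simp only [Finset.mem_image, Finset.mem_filter] at ht
        obtain ⟨s, ⟨hs, hs'⟩, rfl⟩ := ht
        have := hS s hs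
        rw [hs'] at this
        exact this
      · rw [Finset.mem_filter] at ht0
        have h1 := hS t0 ht0.1
        rw [ht0.2] at h1
        obtain ⟨s, bx⟩ := h1
        simp only at s bx
        have tau : ∀ n : ℤ, 0 < n → Squarefree n → (n.natAbs.divisors.card : ℝ) ≤ c * (n : ℝ) ^ ε := by
          intro n hn hs
          have := hc n.natAbs (Int.squarefree_natAbs.2 hs)
          have e : ((n.natAbs : ℕ) : ℝ) = n := by
            rw [Nat.cast_natAbs, abs_of_pos hn]
          rwa [e] at this
        have hp : (0 : ℝ) < p := by exact_mod_cast s.hp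
        have hq : (0 : ℝ) < q := by exact_mod_cast s.hq
        have hr : (0 : ℝ) < r := by exact_mod_cast s.hr
        rw [← ha, ← hb]
        refine mul_le_mul_of_nonneg_left ?_ (by positivity)
        calc _ ≤ (c * (p : ℝ) ^ ε) * (c * (q : ℝ) ^ ε) * (c * (r : ℝ) ^ ε) := by
              gcongr
              · exact tau p s.hp s.sp
              · exact tau q s.hq s.sq
              · exact tau r s.hr s.sr
          _ = c ^ 3 * (p * q * r : ℝ) ^ ε := by
              rw [Real.mul_rpow (by positivity) (by positivity), Real.mul_rpow (by positivity) (by positivity)]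
              ring
          _ ≤ c ^ 3 * (8 * a) ^ ε := by
              refine mul_le_mul_of_nonneg_left (Real.rpow_le_rpow (by positivity) ?_ hε.le) (by positivity)
              calc (p * q * r : ℝ) ≤ (2 * P) * (2 * Q) * (2 * R) := by
                    gcongr
                    · exact bx.p2
                    · exact bx.q2
                    · exact bx.r2
                _ = 8 * a := by rw [ha]; ring

lemma pell_sqf_unique (d b d' b' : ℤ) (hd : 0 < d) (hb : 0 < b) (hd' : 0 < d') (hb' : 0 < b')
    (s : Squarefree d) (s' : Squarefree d') (h : d * b ^ 2 = d' * b' ^ 2) : d = d' ∧ b = b' := by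
  have aux : ∀ d b d' b' : ℤ, 0 < d → 0 < b → 0 < d' → 0 < b' → Squarefree d' →
      d * b ^ 2 = d' * b' ^ 2 → b ∣ b' := by
    intro d b d' b' hd hb hd' hb' s' h
    have hg : (Int.gcd b b') ≠ 0 := by
      intro h0; exact hb.ne' (Int.gcd_eq_zero_iff.1 h0).1
    obtain ⟨β, hβ⟩ := Int.gcd_dvd_left b b'
    obtain ⟨β', hβ'⟩ := Int.gcd_dvd_right b b'
    have cop : IsCoprime β β' := by
      have hb2 := Int.gcd_eq_gcd_ab b b'
      have hg' : ((Int.gcd b b' : ℕ) : ℤ) ≠ 0 := by exact_mod_cast hg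
      refine ⟨Int.gcdA b b', Int.gcdB b b', mul_left_cancel₀ hg' ?_⟩
      linear_combination -hb2 - Int.gcdA b b' * hβ - Int.gcdB b b' * hβ'
    have hg' : ((Int.gcd b b' : ℕ) : ℤ) ≠ 0 := by exact_mod_cast hg
    have h2 : d * β ^ 2 = d' * β' ^ 2 := by
      apply mul_left_cancel₀ (pow_ne_zero 2 hg')
      have h3 := h
      generalize (Int.gcd b b' : ℤ) = g at *
      rw [hβ, hβ'] at h3
      linarith
    have h3 : β * β ∣ d' := by
      have : β ^ 2 ∣ d' * β' ^ 2 := ⟨d, by linarith⟩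
      rw [← pow_two]
      exact (cop.pow (m := 2) (n := 2)).dvd_of_dvd_mul_right this
    have h4 := s' β h3
    have : b ∣ (Int.gcd b b' : ℤ) := by
      conv_lhs => rw [hβ]
      exact h4.mul_right_dvd.2 dvd_rfl
    exact this.trans (Int.gcd_dvd_right b b')
  have h1 := aux d b d' b' hd hb hd' hb' s' h
  have h2 := aux d' b' d b hd' hb' hd hb s h.symm
  have h3 : b = b' := Int.dvd_antisymm hb.le hb'.le h1 h2
  subst h3
  exact ⟨mul_right_cancel₀ (pow_ne_zero 2 hb.ne') h, rfl⟩

lemma pell_sols (d₁ d₂ d₃ d₄ b₁ b₂ b₃ b₄ : ℤ) (h1 : 0 < d₁) (h2 : 0 < d₂) (h3 : 0 < d₃)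
    (h4 : 0 < d₄) (k1 : 0 < b₁) (k2 : 0 < b₂) (k3 : 0 < b₃) (k4 : 0 < b₄)
    (hs : Squarefree (d₁ * d₂ * d₃ * d₄)) (hg : Int.gcd (d₁ * b₁) (d₂ * b₂) = 1)
    (e3 : d₂ * b₂ ^ 2 - d₁ * b₁ ^ 2 = d₃ * b₃ ^ 2) (e4 : d₂ * b₂ ^ 2 + d₁ * b₁ ^ 2 = d₄ * b₄ ^ 2) :
    PellSol (-1) 1 d₁ d₂ d₃ b₁ b₂ b₃ ∧ PellSol 1 1 d₁ d₂ d₄ b₁ b₂ b₄ ∧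
    PellSol 1 2 d₃ d₄ d₂ b₃ b₄ b₂ ∧ PellSol (-1) 2 d₃ d₄ d₁ b₃ b₄ b₁ := by
  have hc : IsCoprime (d₁ * b₁) (d₂ * b₂) := Int.isCoprime_iff_gcd_eq_one.2 hg
  obtain ⟨r4, s123, s4⟩ := squarefree_mul_iff.1 hs
  obtain ⟨r3, s12, s3⟩ := squarefree_mul_iff.1 s123
  obtain ⟨r2, s1, s2⟩ := squarefree_mul_iff.1 s12
  have c12 : IsCoprime d₁ d₂ := r2.isCoprime
  have c123 : IsCoprime (d₁ * d₂) d₃ := r3.isCoprime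
  have c1234 : IsCoprime (d₁ * d₂ * d₃) d₄ := r4.isCoprime
  have c13 := c123.of_mul_left_left
  have c23 := c123.of_mul_left_right
  have c34 := c1234.of_mul_left_right
  have c14 := c1234.of_mul_left_left.of_mul_left_left
  have c24 := c1234.of_mul_left_left.of_mul_left_right
  have b12 : IsCoprime b₁ b₂ := hc.of_mul_left_right.of_mul_right_right
  have x1 : IsCoprime b₁ (d₂ * b₂ ^ 2) := by
    rw [pow_two, ← mul_assoc]
    exact hc.of_mul_left_right.mul_right b12
  have x2 : IsCoprime b₂ (d₁ * b₁ ^ 2) := by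
    rw [pow_two, ← mul_assoc]
    exact hc.symm.of_mul_left_right.mul_right b12.symm
  have lem : ∀ a u v d b : ℤ, IsCoprime a u → u + a * v = d * b ^ 2 → IsCoprime a b := by
    intro a u v d b h e
    have : IsCoprime a (u + a * v) := IsCoprime.add_mul_left_right h v
    rw [e, pow_two] at this
    exact this.of_mul_right_right.of_mul_right_right
  have b13 : IsCoprime b₁ b₃ := lem b₁ _ (-(d₁ * b₁)) d₃ b₃ x1 (by linarith)
  have b14 : IsCoprime b₁ b₄ := lem b₁ _ (d₁ * b₁) d₄ b₄ x1 (by linarith)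
  have b23 : IsCoprime b₂ b₃ := lem b₂ _ (-(d₂ * b₂)) (-d₃) b₃ x2 (by linarith)
  have b24 : IsCoprime b₂ b₄ := lem b₂ _ (d₂ * b₂) d₄ b₄ x2 (by linarith)
  have b34 : IsCoprime b₃ b₄ := by
    rw [Int.isCoprime_iff_gcd_eq_one]
    have y : IsCoprime (d₁ * b₁ ^ 2) (d₂ * b₂ ^ 2) := by
      have c1 : IsCoprime (d₁ * b₁ ^ 2) (d₂ * b₂) := by
        rw [pow_two, ← mul_assoc]
        exact hc.mul_left hc.of_mul_left_right
      rw [pow_two b₂, ← mul_assoc]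
      exact c1.mul_right c1.of_mul_right_right
    obtain ⟨u, v, huv⟩ := y
    obtain ⟨m, hm⟩ := Int.gcd_dvd_left b₃ b₄
    obtain ⟨n, hn⟩ := Int.gcd_dvd_right b₃ b₄
    have hg0 : Int.gcd b₃ b₄ ≠ 0 := by
      intro h0; exact k3.ne' (Int.gcd_eq_zero_iff.1 h0).1
    have hdv : ((Int.gcd b₃ b₄ : ℕ) : ℤ) ^ 2 ∣ 2 := by
      generalize (Int.gcd b₃ b₄ : ℤ) = g at *
      refine ⟨u * (d₄ * n ^ 2 - d₃ * m ^ 2) + v * (d₃ * m ^ 2 + d₄ * n ^ 2), ?_⟩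
      rw [hm] at e3
      rw [hn] at e4
      linear_combination (-2) * huv + u * (e4 - e3) + v * (e4 + e3)
    have hdv' : (Int.gcd b₃ b₄) ^ 2 ∣ 2 := by exact_mod_cast hdv
    have := Nat.le_of_dvd (by norm_num) hdv'
    have : Int.gcd b₃ b₄ < 2 := by nlinarith
    omega
  have p1 : 0 < d₁ * b₁ ^ 2 := by positivity
  have p3 : 0 < d₃ * b₃ ^ 2 := by positivity
  refine ⟨⟨h1, h2, h3, k1, k2, k3, s1, s2, s3, c12, c13, c23, b12, b13, b23, by linarith, by linarith⟩,
    ⟨h1, h2, h4, k1, k2, k4, s1, s2, s4, c12, c14, c24, b12, b14, b24, by linarith, by linarith⟩,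
    ⟨h3, h4, h2, k3, k4, k2, s3, s4, s2, c34, c23.symm, c24.symm, b34, b23.symm, b24.symm, by linarith, by linarith⟩,
    ⟨h3, h4, h1, k3, k4, k1, s3, s4, s1, c34, c13.symm, c14.symm, b34, b13.symm, b14.symm, by linarith, by linarith⟩⟩

lemma pell_final (ε C N a1 a2 a3 a4 b1 b2 b3 b4 : ℝ) (hC : 0 < C)
    (ha1 : 0 < a1) (ha2 : 0 < a2) (ha3 : 0 < a3) (ha4 : 0 < a4)
    (hb1 : 0 < b1) (hb2 : 0 < b2) (hb3 : 0 < b3) (hb4 : 0 < b4) (hN : 0 ≤ N)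
    (h1 : N ≤ C * (a1 * a2 * a3) ^ ((2 : ℝ) / 3 + 4 * ε / 3) * (b1 * b2 * b3) ^ ((1 : ℝ) / 3))
    (h2 : N ≤ C * (a1 * a2 * a4) ^ ((2 : ℝ) / 3 + 4 * ε / 3) * (b1 * b2 * b4) ^ ((1 : ℝ) / 3))
    (h3 : N ≤ C * (a3 * a4 * a2) ^ ((2 : ℝ) / 3 + 4 * ε / 3) * (b3 * b4 * b2) ^ ((1 : ℝ) / 3))
    (h4 : N ≤ C * (a3 * a4 * a1) ^ ((2 : ℝ) / 3 + 4 * ε / 3) * (b3 * b4 * b1) ^ ((1 : ℝ) / 3)) :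
    N ≤ C * (a1 * a2 * a3 * a4) ^ ((1 : ℝ) / 2 + ε) * (b1 * b2 * b3 * b4) ^ ((1 : ℝ) / 4) := by
  refine le_of_pow_le_pow_left₀ (n := 4) (by norm_num) (by positivity) ?_
  have e1 : ((a1 * a2 * a3 * a4) ^ ((1 : ℝ) / 2 + ε)) ^ 4 =
      ((a1 * a2 * a3 * a4) ^ ((2 : ℝ) / 3 + 4 * ε / 3)) ^ 3 := by
    rw [← Real.rpow_natCast, ← Real.rpow_natCast, ← Real.rpow_mul (by positivity), ← Real.rpow_mul (by positivity)]
    congr 1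
    push_cast
    ring
  have e2 : ((b1 * b2 * b3 * b4) ^ ((1 : ℝ) / 4)) ^ 4 = ((b1 * b2 * b3 * b4) ^ ((1 : ℝ) / 3)) ^ 3 := by
    rw [← Real.rpow_natCast, ← Real.rpow_natCast, ← Real.rpow_mul (by positivity), ← Real.rpow_mul (by positivity)]
    congr 1
    norm_num
  rw [mul_pow, mul_pow, e1, e2]
  generalize (2 : ℝ) / 3 + 4 * ε / 3 = s at *
  generalize (1 : ℝ) / 3 = u at *
  calc N ^ 4 = N * N * N * N := by ring
    _ ≤ _ := by
      exact mul_le_mul (mul_le_mul (mul_le_mul h1 h2 hN (by positivity)) h3 hN (by positivity)) h4 hN (by positivity)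
    _ = _ := by
      have m3 : ∀ x y z s : ℝ, 0 < x → 0 < y → 0 < z → (x * y * z) ^ s = x ^ s * y ^ s * z ^ s := by
        intro x y z s hx hy hz
        rw [Real.mul_rpow (by positivity) hz.le, Real.mul_rpow hx.le hy.le]
      rw [Real.mul_rpow (x := a1 * a2 * a3) (by positivity) ha4.le, Real.mul_rpow (x := b1 * b2 * b3) (by positivity) hb4.le,
        m3 a1 a2 a3 s, m3 a1 a2 a4 s, m3 a3 a4 a2 s, m3 a3 a4 a1 s,
        m3 b1 b2 b3 u, m3 b1 b2 b4 u, m3 b3 b4 b2 u, m3 b3 b4 b1 u] <;> try assumption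
      ring


/-- Dyadic counting bound for the Pell-type system arising from 2-descent
(case ν = 1). -/
theorem stmt_5 (ε : ℝ) (hε : 0 < ε) :
    ∃ C : ℝ, ∀ D₁ D₂ D₃ D₄ B₁ B₂ B₃ B₄ : ℝ,
      1 / 2 ≤ D₁ → 1 / 2 ≤ D₂ → 1 / 2 ≤ D₃ → 1 / 2 ≤ D₄ →
      1 / 2 ≤ B₁ → 1 / 2 ≤ B₂ → 1 / 2 ≤ B₃ → 1 / 2 ≤ B₄ →
      (Set.ncard { t : ℤ × ℤ × ℤ × ℤ × ℤ × ℤ × ℤ × ℤ |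
        match t with
        | (d₁, d₂, d₃, d₄, b₁, b₂, b₃, b₄) =>
          1 ≤ d₁ ∧ 1 ≤ d₂ ∧ 1 ≤ d₃ ∧ 1 ≤ d₄ ∧
          1 ≤ b₁ ∧ 1 ≤ b₂ ∧ 1 ≤ b₃ ∧ 1 ≤ b₄ ∧
          D₁ < (d₁ : ℝ) ∧ (d₁ : ℝ) ≤ 2 * D₁ ∧
          D₂ < (d₂ : ℝ) ∧ (d₂ : ℝ) ≤ 2 * D₂ ∧
          D₃ < (d₃ : ℝ) ∧ (d₃ : ℝ) ≤ 2 * D₃ ∧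
          D₄ < (d₄ : ℝ) ∧ (d₄ : ℝ) ≤ 2 * D₄ ∧
          B₁ ≤ (b₁ : ℝ) ∧ (b₁ : ℝ) ≤ 2 * B₁ ∧
          B₂ ≤ (b₂ : ℝ) ∧ (b₂ : ℝ) ≤ 2 * B₂ ∧
          B₃ ≤ (b₃ : ℝ) ∧ (b₃ : ℝ) ≤ 2 * B₃ ∧
          B₄ ≤ (b₄ : ℝ) ∧ (b₄ : ℝ) ≤ 2 * B₄ ∧
          Squarefree (d₁ * d₂ * d₃ * d₄) ∧
          Int.gcd (d₁ * b₁) (d₂ * b₂) = 1 ∧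
          d₂ * b₂ ^ 2 - d₁ * b₁ ^ 2 = d₃ * b₃ ^ 2 ∧
          d₂ * b₂ ^ 2 + d₁ * b₁ ^ 2 = d₄ * b₄ ^ 2 } : ℝ) ≤
        C * (D₁ * D₂ * D₃ * D₄) ^ ((1 : ℝ) / 2 + ε) * (B₁ * B₂ * B₃ * B₄) ^ ((1 : ℝ) / 4) := by
  classical
  obtain ⟨C, hC, hT⟩ := pell_T (4 * ε / 3) (by positivity)
  refine ⟨C, ?_⟩
  intro D₁ D₂ D₃ D₄ B₁ B₂ B₃ B₄ hD1 hD2 hD3 hD4 hB1 hB2 hB3 hB4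
  have D1 : 0 < D₁ := by linarith
  have D2 : 0 < D₂ := by linarith
  have D3 : 0 < D₃ := by linarith
  have D4 : 0 < D₄ := by linarith
  have B1 : 0 < B₁ := by linarith
  have B2 : 0 < B₂ := by linarith
  have B3 : 0 < B₃ := by linarith
  have B4 : 0 < B₄ := by linarith
  set A := { t : ℤ × ℤ × ℤ × ℤ × ℤ × ℤ × ℤ × ℤ | _ } with hA
  rcases A.finite_or_infinite with hfin | hinf
  swap
  · rw [hinf.ncard]
    simp only [Nat.cast_zero]
    positivity
  rw [Set.ncard_eq_toFinset_card A hfin]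
  have hm : ∀ t ∈ hfin.toFinset, t ∈ A := fun t ht => hfin.mem_toFinset.1 ht
  generalize hfin.toFinset = F at hm
  refine pell_final ε C F.card D₁ D₂ D₃ D₄ B₁ B₂ B₃ B₄ hC D1 D2 D3 D4 B1 B2 B3 B4 (Nat.cast_nonneg _) ?_ ?_ ?_ ?_
  · have inj : Set.InjOn (fun t : ℤ × ℤ × ℤ × ℤ × ℤ × ℤ × ℤ × ℤ =>
        ((t.1, t.2.1, t.2.2.1), (t.2.2.2.2.1, t.2.2.2.2.2.1, t.2.2.2.2.2.2.1))) (F : Set _) := by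
      rintro ⟨d₁, d₂, d₃, d₄, b₁, b₂, b₃, b₄⟩ ht ⟨d₁', d₂', d₃', d₄', b₁', b₂', b₃', b₄'⟩ ht' h
      obtain ⟨h1, h2, h3, h4, k1, k2, k3, k4, -, -, -, -, -, -, -, -, -, -, -, -, -, -, -, -, hs, hg, e3, e4⟩ := hm _ ht
      obtain ⟨h1', h2', h3', h4', k1', k2', k3', k4', -, -, -, -, -, -, -, -, -, -, -, -, -, -, -, -, hs', hg', e3', e4'⟩ := hm _ ht'
      obtain ⟨u, v, w, -⟩ := pell_sols _ _ _ _ _ _ _ _ h1 h2 h3 h4 k1 k2 k3 k4 hs hg e3 e4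
      obtain ⟨u', v', w', -⟩ := pell_sols _ _ _ _ _ _ _ _ h1' h2' h3' h4' k1' k2' k3' k4' hs' hg' e3' e4'
      simp only [Prod.mk.injEq] at h
      obtain ⟨⟨rfl, rfl, rfl⟩, rfl, rfl, rfl⟩ := h
      obtain ⟨rfl, rfl⟩ := pell_sqf_unique _ _ _ _ h4 k4 h4' k4' v.sr v'.sr (by linarith)
      rfl
    rw [← Finset.card_image_of_injOn inj]
    refine hT (-1) 1 _ _ _ _ _ _ (by norm_num) (by norm_num) hD1 hD2 hD3 hB1 hB2 hB3 _ ?_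
    intro t ht
    rw [Finset.mem_image] at ht
    obtain ⟨⟨d₁, d₂, d₃, d₄, b₁, b₂, b₃, b₄⟩, ht, rfl⟩ := ht
    obtain ⟨h1, h2, h3, h4, k1, k2, k3, k4, l1, m1, l2, m2, l3, m3, l4, m4, x1, y1, x2, y2, x3, y3, x4, y4, hs, hg, e3, e4⟩ := hm _ ht
    obtain ⟨w1, w2, w3, w4⟩ := pell_sols _ _ _ _ _ _ _ _ h1 h2 h3 h4 k1 k2 k3 k4 hs hg e3 e4
    exact ⟨w1, ⟨l1.le, m1, l2.le, m2, l3.le, m3, x1, y1, x2, y2, x3, y3⟩⟩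
  · have inj : Set.InjOn (fun t : ℤ × ℤ × ℤ × ℤ × ℤ × ℤ × ℤ × ℤ =>
        ((t.1, t.2.1, t.2.2.2.1), (t.2.2.2.2.1, t.2.2.2.2.2.1, t.2.2.2.2.2.2.2))) (F : Set _) := by
      rintro ⟨d₁, d₂, d₃, d₄, b₁, b₂, b₃, b₄⟩ ht ⟨d₁', d₂', d₃', d₄', b₁', b₂', b₃', b₄'⟩ ht' h
      obtain ⟨h1, h2, h3, h4, k1, k2, k3, k4, -, -, -, -, -, -, -, -, -, -, -, -, -, -, -, -, hs, hg, e3, e4⟩ := hm _ ht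
      obtain ⟨h1', h2', h3', h4', k1', k2', k3', k4', -, -, -, -, -, -, -, -, -, -, -, -, -, -, -, -, hs', hg', e3', e4'⟩ := hm _ ht'
      obtain ⟨u, v, w, -⟩ := pell_sols _ _ _ _ _ _ _ _ h1 h2 h3 h4 k1 k2 k3 k4 hs hg e3 e4
      obtain ⟨u', v', w', -⟩ := pell_sols _ _ _ _ _ _ _ _ h1' h2' h3' h4' k1' k2' k3' k4' hs' hg' e3' e4'
      simp only [Prod.mk.injEq] at h
      obtain ⟨⟨rfl, rfl, rfl⟩, rfl, rfl, rfl⟩ := h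
      obtain ⟨rfl, rfl⟩ := pell_sqf_unique _ _ _ _ h3 k3 h3' k3' u.sr u'.sr (by linarith)
      rfl
    rw [← Finset.card_image_of_injOn inj]
    refine hT (1) 1 _ _ _ _ _ _ (by norm_num) (by norm_num) hD1 hD2 hD4 hB1 hB2 hB4 _ ?_
    intro t ht
    rw [Finset.mem_image] at ht
    obtain ⟨⟨d₁, d₂, d₃, d₄, b₁, b₂, b₃, b₄⟩, ht, rfl⟩ := ht
    obtain ⟨h1, h2, h3, h4, k1, k2, k3, k4, l1, m1, l2, m2, l3, m3, l4, m4, x1, y1, x2, y2, x3, y3, x4, y4, hs, hg, e3, e4⟩ := hm _ ht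
    obtain ⟨w1, w2, w3, w4⟩ := pell_sols _ _ _ _ _ _ _ _ h1 h2 h3 h4 k1 k2 k3 k4 hs hg e3 e4
    exact ⟨w2, ⟨l1.le, m1, l2.le, m2, l4.le, m4, x1, y1, x2, y2, x4, y4⟩⟩
  · have inj : Set.InjOn (fun t : ℤ × ℤ × ℤ × ℤ × ℤ × ℤ × ℤ × ℤ =>
        ((t.2.2.1, t.2.2.2.1, t.2.1), (t.2.2.2.2.2.2.1, t.2.2.2.2.2.2.2, t.2.2.2.2.2.1))) (F : Set _) := by
      rintro ⟨d₁, d₂, d₃, d₄, b₁, b₂, b₃, b₄⟩ ht ⟨d₁', d₂', d₃', d₄', b₁', b₂', b₃', b₄'⟩ ht' h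
      obtain ⟨h1, h2, h3, h4, k1, k2, k3, k4, -, -, -, -, -, -, -, -, -, -, -, -, -, -, -, -, hs, hg, e3, e4⟩ := hm _ ht
      obtain ⟨h1', h2', h3', h4', k1', k2', k3', k4', -, -, -, -, -, -, -, -, -, -, -, -, -, -, -, -, hs', hg', e3', e4'⟩ := hm _ ht'
      obtain ⟨u, v, w, -⟩ := pell_sols _ _ _ _ _ _ _ _ h1 h2 h3 h4 k1 k2 k3 k4 hs hg e3 e4
      obtain ⟨u', v', w', -⟩ := pell_sols _ _ _ _ _ _ _ _ h1' h2' h3' h4' k1' k2' k3' k4' hs' hg' e3' e4'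
      simp only [Prod.mk.injEq] at h
      obtain ⟨⟨rfl, rfl, rfl⟩, rfl, rfl, rfl⟩ := h
      obtain ⟨rfl, rfl⟩ := pell_sqf_unique _ _ _ _ h1 k1 h1' k1' u.sp u'.sp (by linarith)
      rfl
    rw [← Finset.card_image_of_injOn inj]
    refine hT (1) 2 _ _ _ _ _ _ (by norm_num) (by norm_num) hD3 hD4 hD2 hB3 hB4 hB2 _ ?_
    intro t ht
    rw [Finset.mem_image] at ht
    obtain ⟨⟨d₁, d₂, d₃, d₄, b₁, b₂, b₃, b₄⟩, ht, rfl⟩ := ht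
    obtain ⟨h1, h2, h3, h4, k1, k2, k3, k4, l1, m1, l2, m2, l3, m3, l4, m4, x1, y1, x2, y2, x3, y3, x4, y4, hs, hg, e3, e4⟩ := hm _ ht
    obtain ⟨w1, w2, w3, w4⟩ := pell_sols _ _ _ _ _ _ _ _ h1 h2 h3 h4 k1 k2 k3 k4 hs hg e3 e4
    exact ⟨w3, ⟨l3.le, m3, l4.le, m4, l2.le, m2, x3, y3, x4, y4, x2, y2⟩⟩
  · have inj : Set.InjOn (fun t : ℤ × ℤ × ℤ × ℤ × ℤ × ℤ × ℤ × ℤ =>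
        ((t.2.2.1, t.2.2.2.1, t.1), (t.2.2.2.2.2.2.1, t.2.2.2.2.2.2.2, t.2.2.2.2.1))) (F : Set _) := by
      rintro ⟨d₁, d₂, d₃, d₄, b₁, b₂, b₃, b₄⟩ ht ⟨d₁', d₂', d₃', d₄', b₁', b₂', b₃', b₄'⟩ ht' h
      obtain ⟨h1, h2, h3, h4, k1, k2, k3, k4, -, -, -, -, -, -, -, -, -, -, -, -, -, -, -, -, hs, hg, e3, e4⟩ := hm _ ht
      obtain ⟨h1', h2', h3', h4', k1', k2', k3', k4', -, -, -, -, -, -, -, -, -, -, -, -, -, -, -, -, hs', hg', e3', e4'⟩ := hm _ ht'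
      obtain ⟨u, v, w, -⟩ := pell_sols _ _ _ _ _ _ _ _ h1 h2 h3 h4 k1 k2 k3 k4 hs hg e3 e4
      obtain ⟨u', v', w', -⟩ := pell_sols _ _ _ _ _ _ _ _ h1' h2' h3' h4' k1' k2' k3' k4' hs' hg' e3' e4'
      simp only [Prod.mk.injEq] at h
      obtain ⟨⟨rfl, rfl, rfl⟩, rfl, rfl, rfl⟩ := h
      obtain ⟨rfl, rfl⟩ := pell_sqf_unique _ _ _ _ h2 k2 h2' k2' u.sq u'.sq (by linarith)
      rfl
    rw [← Finset.card_image_of_injOn inj]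
    refine hT (-1) 2 _ _ _ _ _ _ (by norm_num) (by norm_num) hD3 hD4 hD1 hB3 hB4 hB1 _ ?_
    intro t ht
    rw [Finset.mem_image] at ht
    obtain ⟨⟨d₁, d₂, d₃, d₄, b₁, b₂, b₃, b₄⟩, ht, rfl⟩ := ht
    obtain ⟨h1, h2, h3, h4, k1, k2, k3, k4, l1, m1, l2, m2, l3, m3, l4, m4, x1, y1, x2, y2, x3, y3, x4, y4, hs, hg, e3, e4⟩ := hm _ ht
    obtain ⟨w1, w2, w3, w4⟩ := pell_sols _ _ _ _ _ _ _ _ h1 h2 h3 h4 k1 k2 k3 k4 hs hg e3 e4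
    exact ⟨w4, ⟨l3.le, m3, l4.le, m4, l1.le, m1, x3, y3, x4, y4, x1, y1⟩⟩
end

section
/- Fix $\varepsilon > 0$. There exists a constant $C$ depending only on $\varepsilon$ such that for all real numbers $D_1, D_2, D_3, B_1, B_2, B_3 \geq 1/2$, the number of tuples $(d_1,d_2,d_3,b_1,b_2,b_3) \in \mathbb{Z}_{\geq 1}^6$ satisfying $D_i < d_i \leq 2 D_i$ and $B_i \leq b_i \leq 2 B_i$ for $i \in \{1,2,3\}$, with $\gcd(d_i b_i, d_j b_j) = 1$ for all $i \neq j$ in $\{1,2,3\}$, and the equation $d_2 b_2^2 - d_1 b_1^2 = d_3 b_3^2$, is at most $C (D_1 D_2 D_3)^{2/3 + \varepsilon} (B_1 B_2 B_3)^{1/3}$. -/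
structure Sol (D₁ D₂ D₃ B₁ B₂ B₃ : ℝ) (d₁ d₂ d₃ b₁ b₂ b₃ : ℤ) : Prop where
  d1 : 1 ≤ d₁
  d2 : 1 ≤ d₂
  d3 : 1 ≤ d₃
  b1 : 1 ≤ b₁
  b2 : 1 ≤ b₂
  b3 : 1 ≤ b₃
  D1 : D₁ < (d₁ : ℝ)
  D1' : (d₁ : ℝ) ≤ 2 * D₁
  D2 : D₂ < (d₂ : ℝ)
  D2' : (d₂ : ℝ) ≤ 2 * D₂
  D3 : D₃ < (d₃ : ℝ)
  D3' : (d₃ : ℝ) ≤ 2 * D₃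
  B1 : B₁ ≤ (b₁ : ℝ)
  B1' : (b₁ : ℝ) ≤ 2 * B₁
  B2 : B₂ ≤ (b₂ : ℝ)
  B2' : (b₂ : ℝ) ≤ 2 * B₂
  B3 : B₃ ≤ (b₃ : ℝ)
  B3' : (b₃ : ℝ) ≤ 2 * B₃
  g12 : IsCoprime (d₁ * b₁) (d₂ * b₂)
  g13 : IsCoprime (d₁ * b₁) (d₃ * b₃)
  g23 : IsCoprime (d₂ * b₂) (d₃ * b₃)
  eq : d₂ * b₂ ^ 2 = d₁ * b₁ ^ 2 + d₃ * b₃ ^ 2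

lemma Sol.symm {D₁ D₂ D₃ B₁ B₂ B₃ : ℝ} {d₁ d₂ d₃ b₁ b₂ b₃ : ℤ}
    (h : Sol D₁ D₂ D₃ B₁ B₂ B₃ d₁ d₂ d₃ b₁ b₂ b₃) :
    Sol D₃ D₂ D₁ B₃ B₂ B₁ d₃ d₂ d₁ b₃ b₂ b₁ where
  d1 := h.d3
  d2 := h.d2
  d3 := h.d1
  b1 := h.b3
  b2 := h.b2
  b3 := h.b1
  D1 := h.D3
  D1' := h.D3'
  D2 := h.D2
  D2' := h.D2'
  D3 := h.D1
  D3' := h.D1'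
  B1 := h.B3
  B1' := h.B3'
  B2 := h.B2
  B2' := h.B2'
  B3 := h.B1
  B3' := h.B1'
  g12 := h.g23.symm
  g13 := h.g13.symm
  g23 := h.g12.symm
  eq := by rw [h.eq]; ring

lemma pigeon {α : Type*} [DecidableEq α] (s : Finset α) (f : α → ℝ) (δ R : ℝ) (hδ : 0 < δ)
    (hR : 0 ≤ R)
    (h0 : ∀ a ∈ s, 0 ≤ f a) (h1 : ∀ a ∈ s, f a ≤ R)
    (h : ∀ a ∈ s, ∀ b ∈ s, ∀ c ∈ s, |f a - f b| < δ → |f a - f c| < δ → |f b - f c| < δ →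
      a = b ∨ a = c ∨ b = c) : (s.card : ℝ) ≤ 2 * (1 + R / δ) := by
  have key : s.card ≤ 2 * (Finset.Icc (0 : ℤ) ⌊R / δ⌋).card := by
    apply Finset.card_le_mul_card_image_of_maps_to (f := fun a => ⌊f a / δ⌋)
    · intro a ha
      rw [Finset.mem_Icc]
      have := h0 a ha
      have := h1 a ha
      exact ⟨Int.floor_nonneg.2 (by positivity), Int.floor_le_floor (by gcongr)⟩
    · intro k _
      by_contra hk
      push Not at hk
      obtain ⟨a, b, c, ha, hb, hc, hab, hac, hbc⟩ := Finset.two_lt_card_iff.1 hk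
      simp only [Finset.mem_filter] at ha hb hc
      have cl : ∀ x y : α, ⌊f x / δ⌋ = k → ⌊f y / δ⌋ = k → |f x - f y| < δ := by
        intro x y hx hy
        have := Int.abs_sub_lt_one_of_floor_eq_floor (hx.trans hy.symm)
        rw [← sub_div, abs_div, abs_of_pos hδ, div_lt_one hδ] at this
        exact this
      rcases h a ha.1 b hb.1 c hc.1 (cl _ _ ha.2 hb.2) (cl _ _ ha.2 hc.2) (cl _ _ hb.2 hc.2)
        with h | h | h
      · exact hab h
      · exact hac h
      · exact hbc h
  have h2 : (0 : ℤ) ≤ ⌊R / δ⌋ := Int.floor_nonneg.2 (by positivity)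
  rw [Int.card_Icc] at key
  have h3 : (((⌊R / δ⌋ + 1 - 0).toNat : ℤ) : ℝ) ≤ R / δ + 1 := by
    rw [Int.toNat_of_nonneg (by omega)]
    push_cast
    linarith [Int.floor_le (R / δ)]
  have h4 : (s.card : ℝ) ≤ 2 * ((⌊R / δ⌋ + 1 - 0).toNat : ℝ) := by exact_mod_cast key
  rw [Int.cast_natCast] at h3
  linarith

lemma prop_eq {a b a' b' : ℤ} (ha : 1 ≤ a) (ha' : 1 ≤ a')
    (h : IsCoprime a b) (h' : IsCoprime a' b') (e : a * b' = a' * b) : a = a' ∧ b = b' := by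
  have h1 : a ∣ a' := h.dvd_of_dvd_mul_right (Dvd.intro _ e)
  have h2 : a' ∣ a := h'.dvd_of_dvd_mul_right (Dvd.intro _ e.symm)
  have h3 : a = a' := Int.dvd_antisymm (by omega) (by omega) h1 h2
  subst h3
  exact ⟨rfl, (mul_left_cancel₀ (by omega) e).symm⟩

lemma bound_b {D₁ D₂ D₃ B₁ B₂ B₃ : ℝ} (hD₁ : 0 < D₁) (hD₃ : 0 < D₃) (hB₂ : 0 < B₂)
    (b₁ b₂ b₃ : ℤ) (s : Finset (ℤ × ℤ × ℤ))
    (hs : ∀ d ∈ s, Sol D₁ D₂ D₃ B₁ B₂ B₃ d.1 d.2.1 d.2.2 b₁ b₂ b₃) :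
    (s.card : ℝ) ≤ 2 * (1 + 8 * (D₁ * D₃ / B₂ ^ 2)) := by
  rcases s.eq_empty_or_nonempty with rfl | ⟨d0, hd0⟩
  · simp; positivity
  have hb2 := (hs d0 hd0).b2
  have hb2B := (hs d0 hd0).B2
  have hb2' : (0 : ℝ) < b₂ := by exact_mod_cast (by omega : 0 < b₂)
  have := pigeon s (fun d => (d.1 : ℝ) / d.2.2) ((b₂ : ℝ) ^ 2 / (4 * D₃ ^ 2)) (2 * D₁ / D₃)
    (by positivity) (by positivity) ?_ ?_ ?_
  · refine this.trans ?_
    have e : 2 * D₁ / D₃ / ((b₂ : ℝ) ^ 2 / (4 * D₃ ^ 2)) = 8 * (D₁ * D₃ / (b₂ : ℝ) ^ 2) := by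
      field_simp; ring
    rw [e]
    gcongr
  · intro d hd
    have h := hs d hd
    have h1 : (1 : ℝ) ≤ d.1 := by exact_mod_cast h.d1
    have h2 : (1 : ℝ) ≤ d.2.2 := by exact_mod_cast h.d3
    positivity
  · intro d hd
    have h := hs d hd
    exact div_le_div₀ (by positivity) h.D1' hD₃ h.D3.le
  · intro d hd d' hd' _ _ hlt _ _
    left
    have h := hs d hd
    have h' := hs d' hd'
    have p3 : (0 : ℝ) < d.2.2 := hD₃.trans h.D3
    have p3' : (0 : ℝ) < d'.2.2 := hD₃.trans h'.D3
    have hdvd : b₂ ^ 2 ∣ d.1 * d'.2.2 - d'.1 * d.2.2 := by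
      have hc : IsCoprime (b₂ ^ 2) (b₃ ^ 2) :=
        (h.g23.of_mul_left_right.of_mul_right_right).pow
      refine hc.dvd_of_dvd_mul_left ⟨d.1 * d'.2.1 - d'.1 * d.2.1, ?_⟩
      linear_combination d'.1 * h.eq - d.1 * h'.eq
    have habs : |((d.1 * d'.2.2 - d'.1 * d.2.2 : ℤ) : ℝ)| < (b₂ : ℝ) ^ 2 := by
      rw [div_sub_div _ _ p3.ne' p3'.ne', abs_div, abs_of_pos (mul_pos p3 p3'),
        div_lt_div_iff₀ (by positivity) (by positivity)] at hlt
      have h4 : (d.2.2 : ℝ) * d'.2.2 ≤ 4 * D₃ ^ 2 := by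
        have := mul_le_mul h.D3' h'.D3' p3'.le (by positivity)
        linarith
      push_cast
      have h5 : |(d.1 : ℝ) * d'.2.2 - d'.1 * d.2.2| * (4 * D₃ ^ 2) < b₂ ^ 2 * (4 * D₃ ^ 2) := by
        rw [mul_comm (d'.1 : ℝ)]
        exact hlt.trans_le (by gcongr)
      exact lt_of_mul_lt_mul_right h5 (by positivity)
    have habs' : |d.1 * d'.2.2 - d'.1 * d.2.2| < b₂ ^ 2 := by exact_mod_cast habs
    have hz := Int.eq_zero_of_abs_lt_dvd hdvd habs'
    obtain ⟨e1, e3⟩ := prop_eq h.d1 h'.d1 (h.g13.of_mul_left_left.of_mul_right_left)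
      (h'.g13.of_mul_left_left.of_mul_right_left) (by linarith : d.1 * d'.2.2 = d'.1 * d.2.2)
    have e2 : d.2.1 = d'.2.1 := by
      have : d.2.1 * b₂ ^ 2 = d'.2.1 * b₂ ^ 2 := by rw [h.eq, h'.eq, e1, e3]
      exact mul_right_cancel₀ (by positivity) this
    exact Prod.ext e1 (Prod.ext e2 e3)

lemma lat {d u v u' v' u0 v0 α β : ℤ} (hd : 1 ≤ d) (hα : IsCoprime α d)
    (hu : IsCoprime u d) (hv0 : IsCoprime v0 d)
    (e : d ∣ α * u ^ 2 - β * v ^ 2) (e' : d ∣ α * u' ^ 2 - β * v' ^ 2)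
    (e0 : d ∣ α * u0 ^ 2 - β * v0 ^ 2)
    (hg : Int.gcd (u * v0 - v * u0) d = Int.gcd (u' * v0 - v' * u0) d) :
    d ∣ 2 * (u * v' - v * u') := by
  have main : ∀ x y : ℤ, d ∣ α * x ^ 2 - β * y ^ 2 →
      d ∣ (x * v0 - y * u0) * (x * v0 + y * u0) := by
    intro x y hx
    refine hα.symm.dvd_of_dvd_mul_left ?_
    have := dvd_sub (hx.mul_right (v0 ^ 2)) (e0.mul_right (y ^ 2))
    convert this using 1
    ring
  set g : ℤ := (Int.gcd (u * v0 - v * u0) d : ℤ) with hgdef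
  have hgd : g ∣ d := Int.gcd_dvd_right _ _
  have g1 : g ∣ u * v0 - v * u0 := Int.gcd_dvd_left _ _
  have g1' : g ∣ u' * v0 - v' * u0 := by rw [hgdef, hg]; exact Int.gcd_dvd_left _ _
  obtain ⟨h, hh⟩ := hgd
  have hgpos : g ≠ 0 := by rintro h0; rw [h0] at hh; omega
  have second : ∀ x y : ℤ, (Int.gcd (x * v0 - y * u0) d : ℤ) = g → d ∣ α * x ^ 2 - β * y ^ 2 →
      h ∣ x * v0 + y * u0 := by
    intro x y hx hxy
    have h1 := main x y hxy
    obtain ⟨m, hm⟩ : g ∣ x * v0 - y * u0 := by rw [← hx]; exact Int.gcd_dvd_left _ _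
    have hc : IsCoprime m h := by
      have hb := Int.gcd_eq_gcd_ab (x * v0 - y * u0) d
      rw [hx, hm] at hb
      refine ⟨Int.gcdA (x * v0 - y * u0) d, Int.gcdB (x * v0 - y * u0) d, ?_⟩
      apply mul_left_cancel₀ hgpos
      rw [hm]
      linear_combination -hb - (Int.gcdB (g * m) d) * hh
    rw [hm] at h1
    have h2 : g * h ∣ g * (m * (x * v0 + y * u0)) := by
      rw [← hh]; convert h1 using 1; ring
    exact hc.symm.dvd_of_dvd_mul_left ((mul_dvd_mul_iff_left hgpos).1 h2)
  have h1 := second u v rfl e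
  have h1' := second u' v' (by rw [hgdef, hg]) e'
  have cg : IsCoprime v0 g := hv0.of_isCoprime_of_dvd_right ⟨h, hh⟩
  have ch : IsCoprime v0 h := hv0.of_isCoprime_of_dvd_right ⟨g, by rw [hh]; ring⟩
  have k1 : g ∣ u * v' - v * u' := by
    refine cg.symm.dvd_of_dvd_mul_left ?_
    convert dvd_sub (g1.mul_right v') (g1'.mul_right v) using 1; ring
  have k2 : h ∣ u * v' - v * u' := by
    refine ch.symm.dvd_of_dvd_mul_left ?_
    convert dvd_sub (h1.mul_right v') (h1'.mul_right v) using 1; ring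
  have hc2 : (Int.gcd g h : ℤ) ∣ 2 := by
    have c1 : (Int.gcd g h : ℤ) ∣ g := Int.gcd_dvd_left _ _
    have c2 : (Int.gcd g h : ℤ) ∣ h := Int.gcd_dvd_right _ _
    have c3 : (Int.gcd g h : ℤ) ∣ 2 * (u * v0) := by
      have e2 : 2 * (u * v0) = (u * v0 - v * u0) + (u * v0 + v * u0) := by ring
      rw [e2]; exact dvd_add (c1.trans g1) (c2.trans h1)
    have c4 : IsCoprime (u * v0) (Int.gcd g h : ℤ) :=
      (hu.mul_left hv0).of_isCoprime_of_dvd_right (c1.trans ⟨h, hh⟩)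
    exact c4.symm.dvd_of_dvd_mul_right c3
  have hb := Int.gcd_eq_gcd_ab g h
  have : d ∣ (Int.gcd g h : ℤ) * (u * v' - v * u') := by
    rw [hb, hh, add_mul]
    refine dvd_add ?_ ?_
    · rw [mul_assoc]; exact mul_dvd_mul_left g (k2.mul_left _)
    · rw [mul_comm g h, mul_assoc]; exact mul_dvd_mul_left h (k1.mul_left _)
  exact this.trans (mul_dvd_mul_right hc2 _)
lemma sum_tau (n : ℕ) : ((∑ d ∈ Finset.Icc 1 n, d.divisors.card : ℕ) : ℝ) ≤ n * (1 + Real.log n) := by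
  have h1 : ∑ d ∈ Finset.Icc 1 n, d.divisors.card = ∑ k ∈ Finset.Icc 1 n, n / k := by
    have : ∀ d ∈ Finset.Icc 1 n, d.divisors.card = ∑ k ∈ Finset.Icc 1 n, if k ∣ d then 1 else 0 := by
      intro d hd
      rw [Finset.mem_Icc] at hd
      rw [← Finset.card_filter]
      congr 1
      ext k
      simp only [Nat.mem_divisors, Finset.mem_filter, Finset.mem_Icc]
      constructor
      · rintro ⟨h, _⟩
        exact ⟨⟨Nat.pos_of_dvd_of_pos h hd.1, (Nat.le_of_dvd hd.1 h).trans hd.2⟩, h⟩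
      · rintro ⟨_, h⟩
        exact ⟨h, by omega⟩
    rw [Finset.sum_congr rfl this, Finset.sum_comm]
    refine Finset.sum_congr rfl fun k _ => ?_
    rw [← Finset.card_filter]
    exact Nat.Ioc_filter_dvd_card_eq_div n k
  rw [h1]
  push_cast
  calc (∑ k ∈ Finset.Icc 1 n, ((n / k : ℕ) : ℝ)) ≤ ∑ k ∈ Finset.Icc 1 n, (n : ℝ) * (k : ℝ)⁻¹ := by
        refine Finset.sum_le_sum fun k _ => ?_
        rw [← div_eq_mul_inv]; exact Nat.cast_div_le
    _ = n * ((harmonic n : ℚ) : ℝ) := by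
        rw [← Finset.mul_sum, harmonic_eq_sum_Icc]; push_cast; rfl
    _ ≤ _ := by gcongr; exact harmonic_le_one_add_log n

lemma sum_tau' (ε : ℝ) (hε : 0 < ε) (D : ℝ) (hD : 1 / 2 ≤ D) :
    ((∑ d ∈ Finset.Icc 1 ⌊2 * D⌋₊, d.divisors.card : ℕ) : ℝ) ≤
      2 * (1 + 1 / ε) * 2 ^ ε * (D * D ^ ε) := by
  refine (sum_tau _).trans ?_
  have h1 : (1 : ℝ) ≤ (⌊2 * D⌋₊ : ℝ) := by
    exact_mod_cast Nat.le_floor (by push_cast; linarith)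
  have h2 : (⌊2 * D⌋₊ : ℝ) ≤ 2 * D := Nat.floor_le (by linarith)
  have h3 : Real.log (⌊2 * D⌋₊ : ℝ) ≤ Real.log (2 * D) := Real.log_le_log (by linarith) h2
  have h4 : Real.log (2 * D) ≤ (2 * D) ^ ε / ε := Real.log_le_rpow_div (by linarith) hε
  have h5 : 1 ≤ (2 * D) ^ ε := Real.one_le_rpow (by linarith) hε.le
  have h6 : (2 * D) ^ ε = 2 ^ ε * D ^ ε := Real.mul_rpow (by norm_num) (by linarith)
  calc (⌊2 * D⌋₊ : ℝ) * (1 + Real.log (⌊2 * D⌋₊ : ℝ)) ≤ 2 * D * ((2 * D) ^ ε + (2 * D) ^ ε / ε) := by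
        have := Real.log_nonneg h1
        gcongr
        exact h3.trans h4
    _ = _ := by rw [h6]; ring

lemma conic_param {x1 x2 x3 : ℝ} (h1 : 0 < x1) (h2 : 0 < x2) (h3 : 0 < x3)
    (e : x2 ^ 2 = x1 ^ 2 + x3 ^ 2) (X : ℝ) (hX : x2 ≤ X) :
    ∃ w, 0 < w ∧ w ≤ X ∧ x1 = 2 * w * (x1 / (x2 + x3)) ∧ x2 = w * (1 + (x1 / (x2 + x3)) ^ 2) ∧
      x3 = w * (1 - (x1 / (x2 + x3)) ^ 2) := by
  have h32 : x3 ≤ x2 := by nlinarith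
  refine ⟨(x2 + x3) / 2, by positivity, by linarith, by field_simp, ?_, ?_⟩
  · field_simp; nlinarith
  · field_simp; nlinarith

lemma det_small {w w' w'' t t' t'' X δ : ℝ} (hw : 0 < w) (hw' : 0 < w') (hw'' : 0 < w'')
    (hX : w ≤ X) (hX' : w' ≤ X) (hX'' : w'' ≤ X)
    (h1 : |t - t'| < δ) (h2 : |t - t''| < δ) (h3 : |t' - t''| < δ) :
    |4 * (w * w' * w'') * ((t - t') * (t - t'') * (t' - t''))| ≤ 4 * X ^ 3 * δ ^ 3 := by
  have hδ : 0 ≤ δ := (abs_nonneg _).trans h1.le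
  have hX0 : 0 ≤ X := hw.le.trans hX
  rw [abs_mul, abs_mul (_ * _) (t' - t''), abs_mul (t - t')]
  rw [abs_of_pos (by positivity)]
  calc _ ≤ 4 * (X * X * X) * (δ * δ * δ) := by gcongr
    _ = _ := by ring

/-- determinant -/
def det3 (a b c : ℤ × ℤ × ℤ) : ℤ :=
  a.1 * (b.2.1 * c.2.2 - b.2.2 * c.2.1) - a.2.1 * (b.1 * c.2.2 - b.2.2 * c.1)
    + a.2.2 * (b.1 * c.2.1 - b.2.1 * c.1)

lemma core {D₁ D₂ D₃ B₁ B₂ B₃ : ℝ} (hD₁ : 0 < D₁) (hD₂ : 0 < D₂) (hD₃ : 0 < D₃)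
    (hB₁ : 0 < B₁) (hB₂ : 0 < B₂)
    (d₁ d₂ d₃ : ℤ) (s : Finset (ℤ × ℤ × ℤ))
    (hs : ∀ b ∈ s, Sol D₁ D₂ D₃ B₁ B₂ B₃ d₁ d₂ d₃ b.1 b.2.1 b.2.2)
    (hdet : ∀ a ∈ s, ∀ b ∈ s, ∀ c ∈ s, d₁ * d₂ * d₃ ∣ 2 * det3 a b c) :
    (s.card : ℝ) ≤ 2 * (1 + 16 * (√D₁ * B₁ / √(D₁ * D₂ * D₃))) := by
  rcases s.eq_empty_or_nonempty with rfl | ⟨b0, hb0⟩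
  · simp; positivity
  have h00 := hs b0 hb0
  have q1 : (0 : ℝ) < d₁ := hD₁.trans h00.D1
  have q2 : (0 : ℝ) < d₂ := hD₂.trans h00.D2
  have q3 : (0 : ℝ) < d₃ := hD₃.trans h00.D3
  have r1 : 0 < √(d₁ : ℝ) := Real.sqrt_pos.2 q1
  have r2 : 0 < √(d₂ : ℝ) := Real.sqrt_pos.2 q2
  have r3 : 0 < √(d₃ : ℝ) := Real.sqrt_pos.2 q3
  have s1 : 0 < √D₁ := Real.sqrt_pos.2 hD₁
  have s2 : 0 < √D₂ := Real.sqrt_pos.2 hD₂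
  have hE : 0 < √(D₁ * D₂ * D₃) := Real.sqrt_pos.2 (by positivity)
  have e1 := Real.sq_sqrt q1.le
  have e2 := Real.sq_sqrt q2.le
  have e3 := Real.sq_sqrt q3.le
  set X : ℝ := √(2 * D₂) * (2 * B₂) with hX
  have hX0 : 0 < X := by positivity
  set δ : ℝ := √(D₁ * D₂ * D₃) / (2 * X) with hδ
  have hδ0 : 0 < δ := by positivity
  set R : ℝ := √(2 * D₁) * (2 * B₁) / (√D₂ * B₂) with hR
  have pos : ∀ b ∈ s, (0 : ℝ) < b.1 ∧ (0 : ℝ) < b.2.1 ∧ (0 : ℝ) < b.2.2 := by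
    intro b hb
    have h := hs b hb
    have h1 := h.b1
    have h2 := h.b2
    have h3 := h.b3
    exact ⟨by exact_mod_cast h1, by exact_mod_cast h2, by exact_mod_cast h3⟩
  have par : ∀ b ∈ s, ∃ w, 0 < w ∧ w ≤ X ∧
      √(d₁ : ℝ) * b.1 = 2 * w * (√(d₁ : ℝ) * b.1 / (√(d₂ : ℝ) * b.2.1 + √(d₃ : ℝ) * b.2.2)) ∧
      √(d₂ : ℝ) * b.2.1 =
        w * (1 + (√(d₁ : ℝ) * b.1 / (√(d₂ : ℝ) * b.2.1 + √(d₃ : ℝ) * b.2.2)) ^ 2) ∧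
      √(d₃ : ℝ) * b.2.2 =
        w * (1 - (√(d₁ : ℝ) * b.1 / (√(d₂ : ℝ) * b.2.1 + √(d₃ : ℝ) * b.2.2)) ^ 2) := by
    intro b hb
    obtain ⟨p1, p2, p3⟩ := pos b hb
    have h := hs b hb
    refine conic_param (by positivity) (by positivity) (by positivity) ?_ X ?_
    · have : (d₂ : ℝ) * (b.2.1 : ℝ) ^ 2 = d₁ * (b.1 : ℝ) ^ 2 + d₃ * (b.2.2 : ℝ) ^ 2 := by
        exact_mod_cast h.eq
      rw [mul_pow, mul_pow, mul_pow, e1, e2, e3, this]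
    · exact mul_le_mul (Real.sqrt_le_sqrt h.D2') h.B2' p2.le (by positivity)
  have fin := pigeon s (fun b => √(d₁ : ℝ) * b.1 / (√(d₂ : ℝ) * b.2.1 + √(d₃ : ℝ) * b.2.2)) δ R
    hδ0 (by positivity) ?_ ?_ ?_
  · refine fin.trans (le_of_eq ?_)
    have : R / δ = 16 * (√D₁ * B₁ / √(D₁ * D₂ * D₃)) := by
      rw [hR, hδ, hX, Real.sqrt_mul (by norm_num) D₁, Real.sqrt_mul (by norm_num) D₂]
      have h2 : √(2 : ℝ) ^ 2 = 2 := Real.sq_sqrt (by norm_num)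
      field_simp
      rw [h2]; norm_num
    rw [this]
  · intro b hb
    obtain ⟨p1, p2, p3⟩ := pos b hb
    positivity
  · intro b hb
    obtain ⟨p1, p2, p3⟩ := pos b hb
    have h := hs b hb
    refine div_le_div₀ (by positivity) ?_ (by positivity) ?_
    · exact mul_le_mul (Real.sqrt_le_sqrt h.D1') h.B1' p1.le (by positivity)
    · have : √D₂ * B₂ ≤ √(d₂ : ℝ) * b.2.1 :=
        mul_le_mul (Real.sqrt_le_sqrt h.D2.le) h.B2 hB₂.le r2.le
      have : 0 < √(d₃ : ℝ) * b.2.2 := by positivity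
      linarith
  · intro a ha b hb c hc hab hac hbc
    obtain ⟨w, hw, hwX, ea1, ea2, ea3⟩ := par a ha
    obtain ⟨w', hw', hwX', eb1, eb2, eb3⟩ := par b hb
    obtain ⟨w'', hw'', hwX'', ec1, ec2, ec3⟩ := par c hc
    have inj : ∀ x ∈ s, ∀ y ∈ s, ∀ w w' t : ℝ, 0 < w → 0 < w' → √(d₁ : ℝ) * x.1 = 2 * w * t →
        √(d₂ : ℝ) * x.2.1 = w * (1 + t ^ 2) → √(d₃ : ℝ) * x.2.2 = w * (1 - t ^ 2) →
        √(d₁ : ℝ) * y.1 = 2 * w' * t →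
        √(d₂ : ℝ) * y.2.1 = w' * (1 + t ^ 2) → √(d₃ : ℝ) * y.2.2 = w' * (1 - t ^ 2) → x = y := by
      intro x hx y hy w w' t hw hw' x1 x2 x3 y1 y2 y3
      have hx' := hs x hx
      have hy' := hs y hy
      have f1 : (x.1 : ℝ) * y.2.1 = y.1 * x.2.1 := by
        have : √(d₁ : ℝ) * √(d₂ : ℝ) * ((x.1 : ℝ) * y.2.1) =
            √(d₁ : ℝ) * √(d₂ : ℝ) * (y.1 * x.2.1) := by
          linear_combination (√(d₂ : ℝ) * y.2.1) * x1 + 2 * w * t * y2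
            - (√(d₂ : ℝ) * x.2.1) * y1 - 2 * w' * t * x2
        exact mul_left_cancel₀ (by positivity) this
      have f2 : (x.1 : ℝ) * y.2.2 = y.1 * x.2.2 := by
        have : √(d₁ : ℝ) * √(d₃ : ℝ) * ((x.1 : ℝ) * y.2.2) =
            √(d₁ : ℝ) * √(d₃ : ℝ) * (y.1 * x.2.2) := by
          linear_combination (√(d₃ : ℝ) * y.2.2) * x1 + 2 * w * t * y3
            - (√(d₃ : ℝ) * x.2.2) * y1 - 2 * w' * t * x3
        exact mul_left_cancel₀ (by positivity) this
      obtain ⟨g1, g2⟩ := prop_eq hx'.b1 hy'.b1 hx'.g12.of_mul_left_right.of_mul_right_right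
        hy'.g12.of_mul_left_right.of_mul_right_right (by exact_mod_cast f1)
      obtain ⟨_, g3⟩ := prop_eq hx'.b1 hy'.b1 hx'.g13.of_mul_left_right.of_mul_right_right
        hy'.g13.of_mul_left_right.of_mul_right_right (by exact_mod_cast f2)
      exact Prod.ext g1 (Prod.ext g2 g3)
    generalize √(d₁ : ℝ) * a.1 / (√(d₂ : ℝ) * a.2.1 + √(d₃ : ℝ) * a.2.2) = t at *
    generalize √(d₁ : ℝ) * b.1 / (√(d₂ : ℝ) * b.2.1 + √(d₃ : ℝ) * b.2.2) = t' at *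
    generalize √(d₁ : ℝ) * c.1 / (√(d₂ : ℝ) * c.2.1 + √(d₃ : ℝ) * c.2.2) = t'' at *
    have hdt : √(d₁ : ℝ) * √(d₂ : ℝ) * √(d₃ : ℝ) * (det3 a b c : ℝ) =
        -(4 * (w * w' * w'') * ((t - t') * (t - t'') * (t' - t''))) := by
      have : √(d₁ : ℝ) * √(d₂ : ℝ) * √(d₃ : ℝ) * (det3 a b c : ℝ) =
        (√(d₁ : ℝ) * a.1) * ((√(d₂ : ℝ) * b.2.1) * (√(d₃ : ℝ) * c.2.2)
            - (√(d₃ : ℝ) * b.2.2) * (√(d₂ : ℝ) * c.2.1))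
          - (√(d₂ : ℝ) * a.2.1) * ((√(d₁ : ℝ) * b.1) * (√(d₃ : ℝ) * c.2.2)
            - (√(d₃ : ℝ) * b.2.2) * (√(d₁ : ℝ) * c.1))
          + (√(d₃ : ℝ) * a.2.2) * ((√(d₁ : ℝ) * b.1) * (√(d₂ : ℝ) * c.2.1)
            - (√(d₂ : ℝ) * b.2.1) * (√(d₁ : ℝ) * c.1)) := by
        simp only [det3]; push_cast; ring
      rw [this, ea1, ea2, ea3, eb1, eb2, eb3, ec1, ec2, ec3]
      ring
    have small := det_small hw hw' hw'' hwX hwX' hwX'' hab hac hbc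
    rw [← abs_neg, ← hdt] at small
    have hsm : 4 * X ^ 3 * δ ^ 3 = √(D₁ * D₂ * D₃) ^ 3 / 2 := by
      rw [hδ]; field_simp; norm_num
    rw [hsm] at small
    have hz : det3 a b c = 0 := by
      by_contra hne
      have hle := Int.le_of_dvd (by positivity) ((dvd_abs _ _).2 (hdet a ha b hb c hc))
      have hle' : (d₁ : ℝ) * d₂ * d₃ ≤ 2 * |(det3 a b c : ℝ)| := by
        rw [abs_mul] at hle
        exact_mod_cast hle
      have hsq : √(d₁ : ℝ) * √(d₂ : ℝ) * √(d₃ : ℝ) = √((d₁ : ℝ) * d₂ * d₃) := by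
        rw [Real.sqrt_mul (by positivity), Real.sqrt_mul q1.le]
      have hgt : √(D₁ * D₂ * D₃) < √((d₁ : ℝ) * d₂ * d₃) := by
        apply Real.sqrt_lt_sqrt (by positivity)
        have := h00.D1
        have := h00.D2
        have := h00.D3
        gcongr
      rw [hsq, abs_mul, abs_of_nonneg (Real.sqrt_nonneg _)] at small
      have hcube : √(D₁ * D₂ * D₃) ^ 3 < √((d₁ : ℝ) * d₂ * d₃) ^ 3 := by gcongr
      have hc2 : √((d₁ : ℝ) * d₂ * d₃) ^ 3 = √((d₁ : ℝ) * d₂ * d₃) * ((d₁ : ℝ) * d₂ * d₃) := by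
        rw [pow_succ, Real.sq_sqrt (by positivity)]; ring
      have := mul_le_mul_of_nonneg_left hle' (Real.sqrt_nonneg ((d₁ : ℝ) * d₂ * d₃))
      linarith
    rw [hz] at hdt
    have h0 : (t - t') * (t - t'') * (t' - t'') = 0 := by
      have : 4 * (w * w' * w'') ≠ 0 := by positivity
      rw [Int.cast_zero, mul_zero] at hdt
      exact (mul_eq_zero.1 (neg_eq_zero.1 hdt.symm)).resolve_left this
    rcases mul_eq_zero.1 h0 with h0 | h0
    · rcases mul_eq_zero.1 h0 with h0 | h0
      · rw [sub_eq_zero] at h0; subst h0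
        exact Or.inl (inj a ha b hb _ _ _ hw hw' ea1 ea2 ea3 eb1 eb2 eb3)
      · rw [sub_eq_zero] at h0; subst h0
        exact Or.inr (Or.inl (inj a ha c hc _ _ _ hw hw'' ea1 ea2 ea3 ec1 ec2 ec3))
    · rw [sub_eq_zero] at h0; subst h0
      exact Or.inr (Or.inr (inj b hb c hc _ _ _ hw' hw'' eb1 eb2 eb3 ec1 ec2 ec3))

lemma core_min {D₁ D₂ D₃ B₁ B₂ B₃ : ℝ} (hD₁ : 0 < D₁) (hD₂ : 0 < D₂) (hD₃ : 0 < D₃)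
    (hB₁ : 0 < B₁) (hB₂ : 0 < B₂) (hB₃ : 0 < B₃)
    (d₁ d₂ d₃ : ℤ) (s : Finset (ℤ × ℤ × ℤ))
    (hs : ∀ b ∈ s, Sol D₁ D₂ D₃ B₁ B₂ B₃ d₁ d₂ d₃ b.1 b.2.1 b.2.2)
    (hdet : ∀ a ∈ s, ∀ b ∈ s, ∀ c ∈ s, d₁ * d₂ * d₃ ∣ 2 * det3 a b c) :
    (s.card : ℝ) ≤ 2 * (1 + 16 * (min (√D₁ * B₁) (√D₃ * B₃) / √(D₁ * D₂ * D₃))) := by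
  rcases min_choice (√D₁ * B₁) (√D₃ * B₃) with h | h
  · rw [h]; exact core hD₁ hD₂ hD₃ hB₁ hB₂ d₁ d₂ d₃ s hs hdet
  · rw [h]
    let e : ℤ × ℤ × ℤ ↪ ℤ × ℤ × ℤ := ⟨fun b => (b.2.2, b.2.1, b.1), by
      rintro ⟨x, y, z⟩ ⟨x', y', z'⟩ h
      simp only [Prod.mk.injEq] at h ⊢
      tauto⟩
    have := core hD₃ hD₂ hD₁ hB₃ hB₂ d₃ d₂ d₁ (s.map e) (B₃ := B₁) ?_ ?_
    · rw [Finset.card_map] at this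
      rwa [show D₃ * D₂ * D₁ = D₁ * D₂ * D₃ by ring] at this
    · intro b hb
      obtain ⟨b, hb0, rfl⟩ := Finset.mem_map.1 hb
      exact (hs b hb0).symm
    · intro a ha b hb c hc
      obtain ⟨a, ha0, rfl⟩ := Finset.mem_map.1 ha
      obtain ⟨b, hb0, rfl⟩ := Finset.mem_map.1 hb
      obtain ⟨c, hc0, rfl⟩ := Finset.mem_map.1 hc
      have := hdet a ha0 b hb0 c hc0
      rw [← dvd_neg]
      have e1 : d₃ * d₂ * d₁ = d₁ * d₂ * d₃ := by ring
      have e2 : -(2 * det3 (e a) (e b) (e c)) = 2 * det3 a b c := by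
        change -(2 * det3 (a.2.2, a.2.1, a.1) (b.2.2, b.2.1, b.1) (c.2.2, c.2.1, c.1)) = _
        simp only [det3]; ring
      rw [e1, e2]; exact this

lemma det_dvd {d₁ d₂ d₃ : ℤ} (h12 : IsCoprime d₁ d₂) (h13 : IsCoprime d₁ d₃)
    (h23 : IsCoprime d₂ d₃) (a b c : ℤ × ℤ × ℤ)
    (k1 : ∀ x ∈ [a, b, c], ∀ y ∈ [a, b, c], d₁ ∣ 2 * (x.2.1 * y.2.2 - x.2.2 * y.2.1))
    (k2 : ∀ x ∈ [a, b, c], ∀ y ∈ [a, b, c], d₂ ∣ 2 * (x.1 * y.2.2 - x.2.2 * y.1))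
    (k3 : ∀ x ∈ [a, b, c], ∀ y ∈ [a, b, c], d₃ ∣ 2 * (x.2.1 * y.1 - x.1 * y.2.1)) :
    d₁ * d₂ * d₃ ∣ 2 * det3 a b c := by
  refine IsCoprime.mul_dvd (h13.mul_left h23) (h12.mul_dvd ?_ ?_) ?_
  · have h := dvd_add (dvd_sub ((k1 b (by simp) c (by simp)).mul_left a.1)
      ((k1 a (by simp) c (by simp)).mul_left b.1)) ((k1 a (by simp) b (by simp)).mul_left c.1)
    convert h using 1
    simp only [det3]; ring
  · have h := dvd_add (dvd_sub ((k2 a (by simp) c (by simp)).mul_left b.2.1)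
      ((k2 b (by simp) c (by simp)).mul_left a.2.1)) ((k2 b (by simp) a (by simp)).mul_left c.2.1)
    convert h using 1
    simp only [det3]; ring
  · have h := dvd_add (dvd_sub ((k3 a (by simp) c (by simp)).mul_left b.2.2)
      ((k3 b (by simp) c (by simp)).mul_left a.2.2)) ((k3 b (by simp) a (by simp)).mul_left c.2.2)
    convert h using 1
    simp only [det3]; ring

lemma bound_d {D₁ D₂ D₃ B₁ B₂ B₃ : ℝ} (hD₁ : 0 < D₁) (hD₂ : 0 < D₂) (hD₃ : 0 < D₃)
    (hB₁ : 0 < B₁) (hB₂ : 0 < B₂) (hB₃ : 0 < B₃)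
    (d₁ d₂ d₃ : ℤ) (s : Finset (ℤ × ℤ × ℤ))
    (hs : ∀ b ∈ s, Sol D₁ D₂ D₃ B₁ B₂ B₃ d₁ d₂ d₃ b.1 b.2.1 b.2.2) :
    (s.card : ℝ) ≤ ((d₁.natAbs.divisors.card * (d₂.natAbs.divisors.card *
      d₃.natAbs.divisors.card) : ℕ) : ℝ) *
      (2 * (1 + 16 * (min (√D₁ * B₁) (√D₃ * B₃) / √(D₁ * D₂ * D₃)))) := by
  rcases s.eq_empty_or_nonempty with rfl | ⟨z, hz⟩
  · simp; positivity
  have h0 := hs z hz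
  have hd1 := h0.d1
  have hd2 := h0.d2
  have hd3 := h0.d3
  let F : ℤ × ℤ × ℤ → ℕ × ℕ × ℕ := fun b =>
    (Int.gcd (b.2.1 * z.2.2 - b.2.2 * z.2.1) d₁, Int.gcd (b.1 * z.2.2 - b.2.2 * z.1) d₂,
      Int.gcd (b.2.1 * z.1 - b.1 * z.2.1) d₃)
  have hF : ∀ b ∈ s, F b ∈ d₁.natAbs.divisors ×ˢ d₂.natAbs.divisors ×ˢ d₃.natAbs.divisors := by
    intro b _
    simp only [F, Finset.mem_product, Nat.mem_divisors]
    exact ⟨⟨Int.gcd_dvd_natAbs_right _ _, by omega⟩, ⟨Int.gcd_dvd_natAbs_right _ _, by omega⟩,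
      ⟨Int.gcd_dvd_natAbs_right _ _, by omega⟩⟩
  rw [Finset.card_eq_sum_card_fiberwise hF]
  push_cast
  have : ∀ k ∈ d₁.natAbs.divisors ×ˢ d₂.natAbs.divisors ×ˢ d₃.natAbs.divisors,
      (((s.filter (fun b => F b = k)).card : ℕ) : ℝ) ≤
      (2 * (1 + 16 * (min (√D₁ * B₁) (√D₃ * B₃) / √(D₁ * D₂ * D₃)))) := by
    intro k _
    apply core_min hD₁ hD₂ hD₃ hB₁ hB₂ hB₃ d₁ d₂ d₃
    · intro b hb
      exact hs b (Finset.mem_filter.1 hb).1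
    · intro a ha b hb c hc
      rw [Finset.mem_filter] at ha hb hc
      have hall : ∀ x ∈ [a, b, c], x ∈ s ∧ F x = k := by
        intro x hx
        simp only [List.mem_cons, List.not_mem_nil, or_false] at hx
        rcases hx with rfl | rfl | rfl <;> assumption
      have c12 : IsCoprime d₁ d₂ := h0.g12.of_mul_left_left.of_mul_right_left
      have c13 : IsCoprime d₁ d₃ := h0.g13.of_mul_left_left.of_mul_right_left
      have c23 : IsCoprime d₂ d₃ := h0.g23.of_mul_left_left.of_mul_right_left
      apply det_dvd c12 c13 c23
      · intro x hx y hy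
        obtain ⟨hx, fx⟩ := hall x hx
        obtain ⟨hy, fy⟩ := hall y hy
        have hx' := hs x hx
        have hy' := hs y hy
        have hg := congrArg (fun p => p.1) (fx.trans fy.symm)
        refine lat (α := d₂) (β := d₃) hd1 c12.symm
          (hx'.g12.of_mul_left_left.of_mul_right_right.symm)
          (h0.g13.of_mul_left_left.of_mul_right_right.symm) ?_ ?_ ?_ hg
        · exact ⟨x.1 ^ 2, by linear_combination hx'.eq⟩
        · exact ⟨y.1 ^ 2, by linear_combination hy'.eq⟩
        · exact ⟨z.1 ^ 2, by linear_combination h0.eq⟩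
      · intro x hx y hy
        obtain ⟨hx, fx⟩ := hall x hx
        obtain ⟨hy, fy⟩ := hall y hy
        have hx' := hs x hx
        have hy' := hs y hy
        have hg := congrArg (fun p => p.2.1) (fx.trans fy.symm)
        refine lat (α := d₁) (β := -d₃) hd2 c12
          (hx'.g12.of_mul_left_right.of_mul_right_left)
          (h0.g23.of_mul_left_left.of_mul_right_right.symm) ?_ ?_ ?_ hg
        · exact ⟨x.2.1 ^ 2, by linear_combination -hx'.eq⟩
        · exact ⟨y.2.1 ^ 2, by linear_combination -hy'.eq⟩
        · exact ⟨z.2.1 ^ 2, by linear_combination -h0.eq⟩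
      · intro x hx y hy
        obtain ⟨hx, fx⟩ := hall x hx
        obtain ⟨hy, fy⟩ := hall y hy
        have hx' := hs x hx
        have hy' := hs y hy
        have hg := congrArg (fun p => p.2.2) (fx.trans fy.symm)
        refine lat (α := d₂) (β := d₁) hd3 c23
          (hx'.g23.of_mul_left_right.of_mul_right_left)
          (h0.g13.of_mul_left_right.of_mul_right_left) ?_ ?_ ?_ hg
        · exact ⟨x.2.2 ^ 2, by linear_combination hx'.eq⟩
        · exact ⟨y.2.2 ^ 2, by linear_combination hy'.eq⟩
        · exact ⟨z.2.2 ^ 2, by linear_combination h0.eq⟩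
  refine (Finset.sum_le_sum this).trans ?_
  rw [Finset.sum_const, Finset.card_product, Finset.card_product, nsmul_eq_mul]
  push_cast
  exact le_rfl

lemma card_Icc_le {B : ℝ} (hB : 0 ≤ B) : ((Finset.Icc 1 ⌊2 * B⌋).card : ℝ) ≤ 2 * B := by
  rw [Int.card_Icc, add_sub_cancel_right]
  have h : (0 : ℤ) ≤ ⌊2 * B⌋ := Int.floor_nonneg.2 (by positivity)
  have h2 : ((⌊2 * B⌋.toNat : ℤ) : ℝ) ≤ 2 * B := by
    rw [Int.toNat_of_nonneg h]; exact Int.floor_le _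
  rwa [Int.cast_natCast] at h2

/-- The solution predicate on tuples. -/
def SolT (D₁ D₂ D₃ B₁ B₂ B₃ : ℝ) (t : ℤ × ℤ × ℤ × ℤ × ℤ × ℤ) : Prop :=
  Sol D₁ D₂ D₃ B₁ B₂ B₃ t.1 t.2.1 t.2.2.1 t.2.2.2.1 t.2.2.2.2.1 t.2.2.2.2.2

lemma total1 {D₁ D₂ D₃ B₁ B₂ B₃ : ℝ} (hD₁ : 0 < D₁) (hD₃ : 0 < D₃)
    (hB₁ : 0 < B₁) (hB₂ : 0 < B₂) (hB₃ : 0 < B₃)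
    (T : Finset (ℤ × ℤ × ℤ × ℤ × ℤ × ℤ)) (hT : ∀ t ∈ T, SolT D₁ D₂ D₃ B₁ B₂ B₃ t) :
    (T.card : ℝ) ≤ 8 * (B₁ * B₂ * B₃) * (2 * (1 + 8 * (D₁ * D₃ / B₂ ^ 2))) := by
  have hF : ∀ t ∈ T, t.2.2.2 ∈ Finset.Icc 1 ⌊2 * B₁⌋ ×ˢ Finset.Icc 1 ⌊2 * B₂⌋ ×ˢ
      Finset.Icc 1 ⌊2 * B₃⌋ := by
    intro t ht
    have h := hT t ht
    simp only [Finset.mem_product, Finset.mem_Icc]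
    exact ⟨⟨h.b1, Int.le_floor.2 h.B1'⟩, ⟨h.b2, Int.le_floor.2 h.B2'⟩,
      ⟨h.b3, Int.le_floor.2 h.B3'⟩⟩
  rw [Finset.card_eq_sum_card_fiberwise hF]
  push_cast
  have : ∀ k ∈ Finset.Icc 1 ⌊2 * B₁⌋ ×ˢ Finset.Icc 1 ⌊2 * B₂⌋ ×ˢ Finset.Icc 1 ⌊2 * B₃⌋,
      (((T.filter (fun t => t.2.2.2 = k)).card : ℕ) : ℝ) ≤
      2 * (1 + 8 * (D₁ * D₃ / B₂ ^ 2)) := by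
    intro k _
    rw [← Finset.card_image_of_injOn (f := fun t => (t.1, t.2.1, t.2.2.1))]
    · apply bound_b (D₂ := D₂) (B₁ := B₁) (B₃ := B₃) hD₁ hD₃ hB₂ k.1 k.2.1 k.2.2
      intro d hd
      obtain ⟨t, ht, rfl⟩ := Finset.mem_image.1 hd
      obtain ⟨ht0, rfl⟩ := Finset.mem_filter.1 ht
      exact hT t ht0
    · rintro ⟨x1, x2, x3, x4⟩ hx ⟨y1, y2, y3, y4⟩ hy h
      have hx2 := (Finset.mem_filter.1 hx).2
      have hy2 := (Finset.mem_filter.1 hy).2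
      simp only [Prod.mk.injEq] at h hx2 hy2 ⊢
      exact ⟨h.1, h.2.1, h.2.2, hx2.trans hy2.symm⟩
  refine (Finset.sum_le_sum this).trans ?_
  rw [Finset.sum_const, Finset.card_product, Finset.card_product, nsmul_eq_mul]
  push_cast
  refine mul_le_mul_of_nonneg_right ?_ (by positivity)
  have h1 := card_Icc_le hB₁.le
  have h2 := card_Icc_le hB₂.le
  have h3 := card_Icc_le hB₃.le
  calc _ ≤ 2 * B₁ * (2 * B₂ * (2 * B₃)) := by gcongr
    _ = _ := by ring

lemma total2 {D₁ D₂ D₃ B₁ B₂ B₃ : ℝ} (hD₁ : 0 < D₁) (hD₂ : 0 < D₂) (hD₃ : 0 < D₃)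
    (hB₁ : 0 < B₁) (hB₂ : 0 < B₂) (hB₃ : 0 < B₃)
    (T : Finset (ℤ × ℤ × ℤ × ℤ × ℤ × ℤ)) (hT : ∀ t ∈ T, SolT D₁ D₂ D₃ B₁ B₂ B₃ t) :
    (T.card : ℝ) ≤ ((∑ d ∈ Finset.Icc 1 ⌊2 * D₁⌋₊, d.divisors.card : ℕ) : ℝ) *
      (((∑ d ∈ Finset.Icc 1 ⌊2 * D₂⌋₊, d.divisors.card : ℕ) : ℝ) *
        ((∑ d ∈ Finset.Icc 1 ⌊2 * D₃⌋₊, d.divisors.card : ℕ) : ℝ)) *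
      (2 * (1 + 16 * (min (√D₁ * B₁) (√D₃ * B₃) / √(D₁ * D₂ * D₃)))) := by
  have hm : ∀ (d : ℤ) (D : ℝ), 1 ≤ d → (d : ℝ) ≤ 2 * D → d.natAbs ∈ Finset.Icc 1 ⌊2 * D⌋₊ := by
    intro d D h1 h2
    rw [Finset.mem_Icc]
    refine ⟨by omega, Nat.le_floor ?_⟩
    have : ((d.natAbs : ℤ) : ℝ) = d := by rw [Int.natAbs_of_nonneg (by omega)]
    rw [Int.cast_natCast] at this
    rwa [this]
  have hF : ∀ t ∈ T, (t.1.natAbs, t.2.1.natAbs, t.2.2.1.natAbs) ∈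
      Finset.Icc 1 ⌊2 * D₁⌋₊ ×ˢ Finset.Icc 1 ⌊2 * D₂⌋₊ ×ˢ Finset.Icc 1 ⌊2 * D₃⌋₊ := by
    intro t ht
    have h := hT t ht
    rw [Finset.mem_product, Finset.mem_product]
    exact ⟨hm _ _ h.d1 h.D1', hm _ _ h.d2 h.D2', hm _ _ h.d3 h.D3'⟩
  rw [Finset.card_eq_sum_card_fiberwise hF]
  rw [Nat.cast_sum]
  have : ∀ k ∈ Finset.Icc 1 ⌊2 * D₁⌋₊ ×ˢ Finset.Icc 1 ⌊2 * D₂⌋₊ ×ˢ Finset.Icc 1 ⌊2 * D₃⌋₊,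
      (((T.filter (fun t => (t.1.natAbs, t.2.1.natAbs, t.2.2.1.natAbs) = k)).card : ℕ) : ℝ) ≤
      ((k.1.divisors.card * (k.2.1.divisors.card * k.2.2.divisors.card) : ℕ) : ℝ) *
      (2 * (1 + 16 * (min (√D₁ * B₁) (√D₃ * B₃) / √(D₁ * D₂ * D₃)))) := by
    intro k _
    have hfib : ∀ t ∈ T.filter (fun t => (t.1.natAbs, t.2.1.natAbs, t.2.2.1.natAbs) = k),
        t.1 = k.1 ∧ t.2.1 = k.2.1 ∧ t.2.2.1 = k.2.2 := by
      intro t ht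
      obtain ⟨ht0, rfl⟩ := Finset.mem_filter.1 ht
      have h := hT t ht0
      have := h.d1
      have := h.d2
      have := h.d3
      refine ⟨?_, ?_, ?_⟩ <;> simp only <;> omega
    rw [← Finset.card_image_of_injOn (f := fun t => t.2.2.2)]
    · refine bound_d hD₁ hD₂ hD₃ hB₁ hB₂ hB₃ (k.1 : ℤ) (k.2.1 : ℤ) (k.2.2 : ℤ) _ ?_
      intro d hd
      obtain ⟨t, ht, rfl⟩ := Finset.mem_image.1 hd
      obtain ⟨h1, h2, h3⟩ := hfib t ht
      rw [← h1, ← h2, ← h3]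
      exact hT t (Finset.mem_filter.1 ht).1
    · rintro ⟨x1, x2, x3, x4⟩ hx ⟨y1, y2, y3, y4⟩ hy h
      obtain ⟨a1, a2, a3⟩ := hfib _ hx
      obtain ⟨c1, c2, c3⟩ := hfib _ hy
      simp only at h a1 a2 a3 c1 c2 c3
      rw [a1, a2, a3, c1, c2, c3, h]
  refine (Finset.sum_le_sum this).trans (le_of_eq ?_)
  rw [← Finset.sum_mul]
  congr 1
  rw [← Nat.cast_sum, Finset.sum_product]
  simp only [Finset.sum_product, ← Finset.mul_sum, ← Finset.sum_mul]
  push_cast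
  rfl

lemma alg (K p x y z a b c g : ℝ) :
    (2 * K * p * (x * a)) * ((2 * K * p * (y * b)) * (2 * K * p * (z * c))) * (2 * (33 * g)) =
      528 * K ^ 3 * (p * p * p) * (a * b * c * (x * y * z * g)) := by ring

lemma final {ε : ℝ} (hε : 0 < ε) {D₁ D₂ D₃ B₁ B₂ B₃ : ℝ} (hD₁ : 1 / 2 ≤ D₁) (hD₂ : 1 / 2 ≤ D₂)
    (hD₃ : 1 / 2 ≤ D₃) (hB₁ : 1 / 2 ≤ B₁) (hB₂ : 1 / 2 ≤ B₂) (hB₃ : 1 / 2 ≤ B₃)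
    (T : Finset (ℤ × ℤ × ℤ × ℤ × ℤ × ℤ)) (hT : ∀ t ∈ T, SolT D₁ D₂ D₃ B₁ B₂ B₃ t) :
    (T.card : ℝ) ≤ (528 * 8 ^ ε + 528 * (1 + 1 / ε) ^ 3 * 8 ^ ε) *
      (D₁ * D₂ * D₃) ^ ((2 : ℝ) / 3 + ε) * (B₁ * B₂ * B₃) ^ ((1 : ℝ) / 3) := by
  have pD₁ : 0 < D₁ := by linarith
  have pD₂ : 0 < D₂ := by linarith
  have pD₃ : 0 < D₃ := by linarith
  have pB₁ : 0 < B₁ := by linarith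
  have pB₂ : 0 < B₂ := by linarith
  have pB₃ : 0 < B₃ := by linarith
  rcases T.eq_empty_or_nonempty with rfl | ⟨t, ht⟩
  · simp; positivity
  have h := hT t ht
  have eqR : (t.2.1 : ℝ) * (t.2.2.2.2.1 : ℝ) ^ 2 =
      t.1 * (t.2.2.2.1 : ℝ) ^ 2 + t.2.2.1 * (t.2.2.2.2.2 : ℝ) ^ 2 := by exact_mod_cast h.eq
  have low1 : D₁ * B₁ ^ 2 ≤ t.1 * (t.2.2.2.1 : ℝ) ^ 2 := by
    have h1 := h.D1.le
    have h2 := h.B1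
    have h3 := pD₁.le.trans h1
    gcongr
  have low3 : D₃ * B₃ ^ 2 ≤ t.2.2.1 * (t.2.2.2.2.2 : ℝ) ^ 2 := by
    have h1 := h.D3.le
    have h2 := h.B3
    have h3 := pD₃.le.trans h1
    gcongr
  have up2 : (t.2.1 : ℝ) * (t.2.2.2.2.1 : ℝ) ^ 2 ≤ 8 * (D₂ * B₂ ^ 2) := by
    have h1 := h.D2'
    have h2 := h.B2'
    have h3 : (0 : ℝ) ≤ t.2.2.2.2.1 := pB₂.le.trans h.B2
    calc _ ≤ (2 * D₂) * (2 * B₂) ^ 2 := by gcongr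
      _ = _ := by ring
  have c1 : D₁ * B₁ ^ 2 ≤ 8 * (D₂ * B₂ ^ 2) := by
    have : 0 ≤ D₃ * B₃ ^ 2 := by positivity
    linarith
  have c3 : D₃ * B₃ ^ 2 ≤ 8 * (D₂ * B₂ ^ 2) := by
    have : 0 ≤ D₁ * B₁ ^ 2 := by positivity
    linarith
  set E := D₁ * D₂ * D₃ with hE
  set F := B₁ * B₂ * B₃ with hF
  have pE : 0 < E := by positivity
  have pF : 0 < F := by positivity
  set e := E ^ ((1 : ℝ) / 3) with he
  set f := F ^ ((1 : ℝ) / 3) with hf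
  have pe : 0 < e := by positivity
  have pf : 0 < f := by positivity
  have e3 : e ^ 3 = E := by
    rw [he, ← Real.rpow_natCast, ← Real.rpow_mul pE.le]; norm_num
  have f3 : f ^ 3 = F := by
    rw [hf, ← Real.rpow_natCast, ← Real.rpow_mul pF.le]; norm_num
  have e23 : E ^ ((2 : ℝ) / 3 + ε) = e ^ 2 * E ^ ε := by
    rw [Real.rpow_add pE, he, ← Real.rpow_natCast, ← Real.rpow_mul pE.le]; norm_num
  have hEε : 1 ≤ 8 ^ ε * E ^ ε := by
    rw [← Real.mul_rpow (by norm_num) pE.le]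
    refine Real.one_le_rpow ?_ hε.le
    have : (1 / 2 : ℝ) * (1 / 2) * (1 / 2) ≤ D₁ * D₂ * D₃ := by gcongr
    linarith
  rw [e23]
  have p8 : (0 : ℝ) < 8 ^ ε := by positivity
  have pEε : 0 < E ^ ε := by positivity
  rcases le_total F E with hFE | hEF
  · have hfe : f ≤ e := Real.rpow_le_rpow pF.le hFE (by norm_num)
    have t1 := total1 pD₁ pD₃ pB₁ pB₂ pB₃ T hT
    have hG : e * f ^ 2 ≤ 4 * (D₂ * B₂ ^ 2) := by
      refine le_of_pow_le_pow_left₀ (n := 3) (by norm_num) (by positivity) ?_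
      have : (e * f ^ 2) ^ 3 = (D₁ * B₁ ^ 2) * (D₂ * B₂ ^ 2) * (D₃ * B₃ ^ 2) := by
        calc (e * f ^ 2) ^ 3 = e ^ 3 * (f ^ 3) ^ 2 := by ring
          _ = _ := by rw [e3, f3, hE, hF]; ring
      rw [this]
      calc _ ≤ (8 * (D₂ * B₂ ^ 2)) * (D₂ * B₂ ^ 2) * (8 * (D₂ * B₂ ^ 2)) := by gcongr
        _ = _ := by ring
    have hH : F * (D₁ * D₃ / B₂ ^ 2) ≤ 4 * (e ^ 2 * f) := by
      have : F * (D₁ * D₃ / B₂ ^ 2) = E * F / (D₂ * B₂ ^ 2) := by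
        rw [hE]; field_simp
      rw [this, div_le_iff₀ (by positivity), ← e3, ← f3]
      calc e ^ 3 * f ^ 3 = e ^ 2 * f * (e * f ^ 2) := by ring
        _ ≤ e ^ 2 * f * (4 * (D₂ * B₂ ^ 2)) := by gcongr
        _ = _ := by ring
    have hF2 : F ≤ e ^ 2 * f := by
      rw [← f3, pow_succ]; gcongr
    have hN : (T.card : ℝ) ≤ 528 * (e ^ 2 * f) := by
      refine t1.trans ?_
      rw [← hF]
      linarith
    calc (T.card : ℝ) ≤ 528 * (e ^ 2 * f) * 1 := by linarith
      _ ≤ 528 * (e ^ 2 * f) * (8 ^ ε * E ^ ε) := by gcongr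
      _ = (528 * 8 ^ ε) * (e ^ 2 * E ^ ε) * f := by ring
      _ ≤ _ := by
        gcongr
        have : 0 ≤ 528 * (1 + 1 / ε) ^ 3 * (8 : ℝ) ^ ε := by positivity
        linarith
  · have hef : e ≤ f := Real.rpow_le_rpow pE.le hEF (by norm_num)
    have t2 := total2 pD₁ pD₂ pD₃ pB₁ pB₂ pB₃ T hT
    rw [← hE] at t2
    set m := min (√D₁ * B₁) (√D₃ * B₃) with hm
    have m0 : 0 < m := lt_min (by positivity) (by positivity)
    have m1 : m ≤ √D₁ * B₁ := min_le_left _ _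
    have m3 : m ≤ √D₃ * B₃ := min_le_right _ _
    have sq1 := Real.sq_sqrt pD₁.le
    have sq2 := Real.sq_sqrt pD₂.le
    have sq3 := Real.sq_sqrt pD₃.le
    have m2 : m ^ 2 ≤ 8 * (D₂ * B₂ ^ 2) := by
      calc m ^ 2 ≤ (√D₁ * B₁) ^ 2 := by gcongr
        _ = D₁ * B₁ ^ 2 := by rw [mul_pow, sq1]
        _ ≤ _ := c1
    have hmE : m / √E ≤ 2 * (f / e) := by
      refine le_of_pow_le_pow_left₀ (n := 6) (by norm_num) (by positivity) ?_
      have hs6 : √E ^ 6 = E ^ 3 := by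
        calc √E ^ 6 = (√E ^ 2) ^ 3 := by ring
          _ = _ := by rw [Real.sq_sqrt pE.le]
      have hm6 : m ^ 6 ≤ 8 * (E * F ^ 2) := by
        calc m ^ 6 = m ^ 2 * m ^ 2 * m ^ 2 := by ring
          _ ≤ (√D₁ * B₁) ^ 2 * (8 * (D₂ * B₂ ^ 2)) * (√D₃ * B₃) ^ 2 := by gcongr
          _ = _ := by rw [mul_pow, mul_pow, sq1, sq3, hE, hF]; ring
      rw [div_pow, mul_pow, div_pow, hs6]
      have e6 : e ^ 6 = E ^ 2 := by rw [← e3]; ring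
      have f6 : f ^ 6 = F ^ 2 := by rw [← f3]; ring
      rw [e6, f6, div_le_iff₀ (by positivity)]
      have : 2 ^ 6 * (F ^ 2 / E ^ 2) * E ^ 3 = 64 * (E * F ^ 2) := by field_simp; norm_num
      rw [this]
      have : 0 ≤ E * F ^ 2 := by positivity
      linarith
    have h1fe : 1 ≤ f / e := (one_le_div pe).2 hef
    have u1 := sum_tau' ε hε D₁ hD₁
    have u2 := sum_tau' ε hε D₂ hD₂
    have u3 := sum_tau' ε hε D₃ hD₃
    set K := 1 + 1 / ε with hK
    have pK : 0 < K := by positivity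
    have h8 : (8 : ℝ) ^ ε = 2 ^ ε * 2 ^ ε * 2 ^ ε := by
      rw [← Real.mul_rpow (by norm_num) (by norm_num), ← Real.mul_rpow (by norm_num) (by norm_num)]
      norm_num
    have hEm : E ^ ε = D₁ ^ ε * D₂ ^ ε * D₃ ^ ε := by
      rw [hE, Real.mul_rpow (by positivity) pD₃.le, Real.mul_rpow pD₁.le pD₂.le]
    calc (T.card : ℝ) ≤ _ := t2
      _ ≤ (2 * K * 2 ^ ε * (D₁ * D₁ ^ ε)) * ((2 * K * 2 ^ ε * (D₂ * D₂ ^ ε)) *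
            (2 * K * 2 ^ ε * (D₃ * D₃ ^ ε))) * (2 * (33 * (f / e))) := by
          have : 2 * (1 + 16 * (m / √E)) ≤ 2 * (33 * (f / e)) := by linarith
          exact mul_le_mul (mul_le_mul u1 (mul_le_mul u2 u3 (Nat.cast_nonneg _) (by positivity))
            (mul_nonneg (Nat.cast_nonneg _) (Nat.cast_nonneg _)) (by positivity)) this
            (by positivity) (by positivity)
      _ = 528 * K ^ 3 * 8 ^ ε * (E ^ ε * (E * (f / e))) := by rw [h8, hEm, hE]; exact alg _ _ _ _ _ _ _ _ _
      _ = 528 * K ^ 3 * 8 ^ ε * (e ^ 2 * E ^ ε) * f := by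
          rw [show E * (f / e) = e ^ 2 * f by rw [← e3]; field_simp]; ring
      _ ≤ _ := by
          gcongr
          have : 0 ≤ 528 * (8 : ℝ) ^ ε := by positivity
          linarith



/-- Dyadic counting bound for the ternary equation `d₂ b₂² - d₁ b₁² = d₃ b₃²`
with pairwise coprimality. -/
theorem stmt_6 (ε : ℝ) (hε : 0 < ε) :
    ∃ C : ℝ, ∀ D₁ D₂ D₃ B₁ B₂ B₃ : ℝ,
      1 / 2 ≤ D₁ → 1 / 2 ≤ D₂ → 1 / 2 ≤ D₃ →
      1 / 2 ≤ B₁ → 1 / 2 ≤ B₂ → 1 / 2 ≤ B₃ →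
      (Set.ncard { t : ℤ × ℤ × ℤ × ℤ × ℤ × ℤ |
        match t with
        | (d₁, d₂, d₃, b₁, b₂, b₃) =>
          1 ≤ d₁ ∧ 1 ≤ d₂ ∧ 1 ≤ d₃ ∧ 1 ≤ b₁ ∧ 1 ≤ b₂ ∧ 1 ≤ b₃ ∧
          D₁ < (d₁ : ℝ) ∧ (d₁ : ℝ) ≤ 2 * D₁ ∧
          D₂ < (d₂ : ℝ) ∧ (d₂ : ℝ) ≤ 2 * D₂ ∧
          D₃ < (d₃ : ℝ) ∧ (d₃ : ℝ) ≤ 2 * D₃ ∧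
          B₁ ≤ (b₁ : ℝ) ∧ (b₁ : ℝ) ≤ 2 * B₁ ∧
          B₂ ≤ (b₂ : ℝ) ∧ (b₂ : ℝ) ≤ 2 * B₂ ∧
          B₃ ≤ (b₃ : ℝ) ∧ (b₃ : ℝ) ≤ 2 * B₃ ∧
          Int.gcd (d₁ * b₁) (d₂ * b₂) = 1 ∧
          Int.gcd (d₁ * b₁) (d₃ * b₃) = 1 ∧
          Int.gcd (d₂ * b₂) (d₃ * b₃) = 1 ∧
          d₂ * b₂ ^ 2 - d₁ * b₁ ^ 2 = d₃ * b₃ ^ 2 } : ℝ) ≤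
        C * (D₁ * D₂ * D₃) ^ ((2 : ℝ) / 3 + ε) * (B₁ * B₂ * B₃) ^ ((1 : ℝ) / 3) := by
  refine ⟨528 * 8 ^ ε + 528 * (1 + 1 / ε) ^ 3 * 8 ^ ε, ?_⟩
  intro D₁ D₂ D₃ B₁ B₂ B₃ hD₁ hD₂ hD₃ hB₁ hB₂ hB₃
  have key : ∀ S : Set (ℤ × ℤ × ℤ × ℤ × ℤ × ℤ), (∀ t ∈ S, SolT D₁ D₂ D₃ B₁ B₂ B₃ t) →
      (S.ncard : ℝ) ≤ (528 * 8 ^ ε + 528 * (1 + 1 / ε) ^ 3 * 8 ^ ε) *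
      (D₁ * D₂ * D₃) ^ ((2 : ℝ) / 3 + ε) * (B₁ * B₂ * B₃) ^ ((1 : ℝ) / 3) := by
    intro S hS
    have hfin : S.Finite := by
      refine (Finset.finite_toSet (Finset.Icc 1 ⌊2 * D₁⌋ ×ˢ Finset.Icc 1 ⌊2 * D₂⌋ ×ˢ
        Finset.Icc 1 ⌊2 * D₃⌋ ×ˢ Finset.Icc 1 ⌊2 * B₁⌋ ×ˢ Finset.Icc 1 ⌊2 * B₂⌋ ×ˢ
        Finset.Icc 1 ⌊2 * B₃⌋)).subset ?_
      intro t ht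
      have h := hS t ht
      simp only [Finset.mem_coe, Finset.mem_product, Finset.mem_Icc]
      exact ⟨⟨h.d1, Int.le_floor.2 h.D1'⟩, ⟨h.d2, Int.le_floor.2 h.D2'⟩,
        ⟨h.d3, Int.le_floor.2 h.D3'⟩, ⟨h.b1, Int.le_floor.2 h.B1'⟩,
        ⟨h.b2, Int.le_floor.2 h.B2'⟩, ⟨h.b3, Int.le_floor.2 h.B3'⟩⟩
    rw [Set.ncard_eq_toFinset_card S hfin]
    refine final hε hD₁ hD₂ hD₃ hB₁ hB₂ hB₃ _ ?_
    intro t ht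
    exact hS t (hfin.mem_toFinset.1 ht)
  apply key
  rintro ⟨d₁, d₂, d₃, b₁, b₂, b₃⟩ ⟨a1, a2, a3, a4, a5, a6, a7, a8, a9, a10, a11, a12, a13, a14,
    a15, a16, a17, a18, g1, g2, g3, e⟩
  exact ⟨a1, a2, a3, a4, a5, a6, a7, a8, a9, a10, a11, a12, a13, a14, a15, a16, a17, a18,
    Int.isCoprime_iff_gcd_eq_one.2 g1, Int.isCoprime_iff_gcd_eq_one.2 g2,
    Int.isCoprime_iff_gcd_eq_one.2 g3, by linear_combination e⟩
end

section
/- Let $(A,B) \in \mathbb{Z}^2$ with $4A^3 + 27B^2 \neq 0$. There exists a constant $C > 0$ depending only on $A$ and $B$ such that for all positive integers $d_0, d_1, b_1, y$ and every integer $x_1$ satisfying $d_0 y^2 = x_1^3 + A x_1 d_1^2 b_1^4 + B d_1^3 b_1^6$, one has $\max\{|x_1|, d_1 b_1^2\} \geq C (d_0 d_1)^{1/4} (b_1 y)^{1/2}$. -/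
/-- Lower bound `max{|x₁|, d₁b₁²} ≫ (d₀d₁)^{1/4} (b₁y)^{1/2}` from the descent
equation. -/
theorem stmt_8 (A B : ℤ) (hAB : 4 * A ^ 3 + 27 * B ^ 2 ≠ 0) :
    ∃ C : ℝ, 0 < C ∧ ∀ d₀ d₁ b₁ y x₁ : ℤ,
      1 ≤ d₀ → 1 ≤ d₁ → 1 ≤ b₁ → 1 ≤ y →
      d₀ * y ^ 2 = x₁ ^ 3 + A * x₁ * d₁ ^ 2 * b₁ ^ 4 + B * d₁ ^ 3 * b₁ ^ 6 →
      max |(x₁ : ℝ)| ((d₁ : ℝ) * (b₁ : ℝ) ^ 2) ≥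
        C * ((d₀ : ℝ) * (d₁ : ℝ)) ^ ((1 : ℝ) / 4) * ((b₁ : ℝ) * (y : ℝ)) ^ ((1 : ℝ) / 2) := by
  have hK1 : (1 : ℝ) ≤ 1 + |(A : ℝ)| + |(B : ℝ)| := by
    have := abs_nonneg (A : ℝ)
    have := abs_nonneg (B : ℝ)
    linarith
  obtain ⟨K, hK⟩ : ∃ K : ℝ, K = 1 + |(A : ℝ)| + |(B : ℝ)| := ⟨_, rfl⟩
  rw [← hK] at hK1
  have hK0 : 0 < K := by linarith
  refine ⟨1 / K, by positivity, ?_⟩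
  intro d₀ d₁ b₁ y x₁ h0 h1 hb hy heq
  have h0' : (1 : ℝ) ≤ d₀ := by exact_mod_cast h0
  have h1' : (1 : ℝ) ≤ d₁ := by exact_mod_cast h1
  have hb' : (1 : ℝ) ≤ b₁ := by exact_mod_cast hb
  have hy' : (1 : ℝ) ≤ y := by exact_mod_cast hy
  have heq' : (d₀ : ℝ) * y ^ 2 = x₁ ^ 3 + A * x₁ * d₁ ^ 2 * b₁ ^ 4 + B * d₁ ^ 3 * b₁ ^ 6 := by
    exact_mod_cast heq
  have hx : |(x₁ : ℝ)| ≤ max |(x₁ : ℝ)| ((d₁ : ℝ) * (b₁ : ℝ) ^ 2) := le_max_left _ _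
  have ht : (d₁ : ℝ) * (b₁ : ℝ) ^ 2 ≤ max |(x₁ : ℝ)| ((d₁ : ℝ) * (b₁ : ℝ) ^ 2) :=
    le_max_right _ _
  generalize max |(x₁ : ℝ)| ((d₁ : ℝ) * (b₁ : ℝ) ^ 2) = M at hx ht ⊢
  have hM : 0 ≤ M := (abs_nonneg _).trans hx
  have ht0 : 0 ≤ (d₁ : ℝ) * (b₁ : ℝ) ^ 2 := by positivity
  have hbound : (d₀ : ℝ) * y ^ 2 ≤ K * M ^ 3 := by
    calc (d₀ : ℝ) * y ^ 2
        = x₁ ^ 3 + A * x₁ * (d₁ * b₁ ^ 2) ^ 2 + B * (d₁ * b₁ ^ 2) ^ 3 := by rw [heq']; ring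
      _ ≤ |(x₁ : ℝ) ^ 3| + |(A : ℝ) * x₁ * (d₁ * b₁ ^ 2) ^ 2| + |(B : ℝ) * (d₁ * b₁ ^ 2) ^ 3| := by
          gcongr <;> exact le_abs_self _
      _ = |(x₁ : ℝ)| ^ 3 + |(A : ℝ)| * |(x₁ : ℝ)| * (d₁ * b₁ ^ 2) ^ 2
            + |(B : ℝ)| * (d₁ * b₁ ^ 2) ^ 3 := by
          simp only [abs_mul, abs_pow]
          rw [abs_of_nonneg (by linarith : (0 : ℝ) ≤ d₁), abs_of_nonneg (by linarith : (0 : ℝ) ≤ b₁)]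
      _ ≤ M ^ 3 + |(A : ℝ)| * M * M ^ 2 + |(B : ℝ)| * M ^ 3 := by gcongr
      _ = K * M ^ 3 := by rw [hK]; ring
  have hX : (((d₀ : ℝ) * d₁) ^ ((1 : ℝ) / 4)) ^ 4 = d₀ * d₁ := by
    rw [← Real.rpow_natCast, ← Real.rpow_mul (by positivity)]; norm_num
  have hY : (((b₁ : ℝ) * y) ^ ((1 : ℝ) / 2)) ^ 2 = b₁ * y := by
    rw [← Real.rpow_natCast, ← Real.rpow_mul (by positivity)]; norm_num
  generalize ((d₀ : ℝ) * d₁) ^ ((1 : ℝ) / 4) = X at hX ⊢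
  generalize ((b₁ : ℝ) * y) ^ ((1 : ℝ) / 2) = Y at hY ⊢
  refine le_of_abs_le (abs_le_of_sq_le_sq' ?_ hM |> fun h => abs_le.2 h)
  refine le_of_abs_le (abs_le_of_sq_le_sq' ?_ (by positivity) |> fun h => abs_le.2 h)
  calc ((1 / K * X * Y) ^ 2) ^ 2 = (1 / K) ^ 4 * (X ^ 4 * (Y ^ 2) ^ 2) := by ring
    _ = (1 / K) ^ 4 * ((d₀ * y ^ 2) * (d₁ * b₁ ^ 2)) := by rw [hX, hY]; ring
    _ ≤ (1 / K) ^ 4 * ((K * M ^ 3) * M) := by gcongr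
    _ = (1 / K) ^ 3 * M ^ 4 := by field_simp
    _ ≤ 1 * M ^ 4 := by
        gcongr
        exact pow_le_one₀ (by positivity) (by rw [div_le_one hK0]; exact hK1)
    _ = (M ^ 2) ^ 2 := by ring
end

section
/- Let $(A,B) \in \mathbb{Z}^2$ with $4A^3 + 27B^2 \neq 0$. There exists a constant $C > 0$ depending only on $A$ and $B$ such that for every squarefree integer $d \geq 1$, every pair of coprime integers $(p,q)$ with $q \geq 1$, and every rational number $y \neq 0$ satisfying $d y^2 = (p/q)^3 + A (p/q) + B$, one has $\max\{|p|, q\} \geq C d^{1/4}$. -/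
/-- Universal lower bound on the naive x-height of a rational point with
nonzero y-coordinate on the quadratic twist `d y² = x³ + A x + B`. -/
theorem stmt_9 (A B : ℤ) (hAB : 4 * A ^ 3 + 27 * B ^ 2 ≠ 0) :
    ∃ C : ℝ, 0 < C ∧ ∀ d : ℤ, 1 ≤ d → Squarefree d →
      ∀ p q : ℤ, Int.gcd p q = 1 → 1 ≤ q → ∀ y : ℚ, y ≠ 0 →
      (d : ℚ) * y ^ 2 = ((p : ℚ) / (q : ℚ)) ^ 3 + (A : ℚ) * ((p : ℚ) / (q : ℚ)) + (B : ℚ) →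
      max |(p : ℝ)| (q : ℝ) ≥ C * (d : ℝ) ^ ((1 : ℝ) / 4) := by
  have hK : (1 : ℝ) ≤ 1 + |(A : ℝ)| + |(B : ℝ)| := by
    have := abs_nonneg (A : ℝ)
    have := abs_nonneg (B : ℝ)
    linarith
  set K : ℝ := 1 + |(A : ℝ)| + |(B : ℝ)| with hKdef
  refine ⟨1 / K, by positivity, ?_⟩
  intro d hd hsq p q _ hq y hy h
  have hq0 : (q : ℚ) ≠ 0 := by
    have : q ≠ 0 := by omega
    exact_mod_cast this
  obtain ⟨z, hz⟩ : ∃ z : ℚ, z = (q : ℚ) ^ 2 * y := ⟨_, rfl⟩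
  have hz0 : z ≠ 0 := by rw [hz]; positivity
  have hzN : (d : ℚ) * z ^ 2 = ((q * (p ^ 3 + A * p * q ^ 2 + B * q ^ 3) : ℤ) : ℚ) := by
    have : (d : ℚ) * z ^ 2 = (q : ℚ) ^ 4 * ((d : ℚ) * y ^ 2) := by rw [hz]; ring
    rw [this, h]
    push_cast
    field_simp
  obtain ⟨N, hN⟩ : ∃ N : ℤ, N = q * (p ^ 3 + A * p * q ^ 2 + B * q ^ 3) := ⟨_, rfl⟩
  rw [← hN] at hzN
  have hden0 : (z.den : ℚ) ≠ 0 := by exact_mod_cast z.den_nz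
  have hab : d * z.num ^ 2 = N * (z.den : ℤ) ^ 2 := by
    have h1 : (d : ℚ) * (z.num : ℚ) ^ 2 = (N : ℚ) * (z.den : ℚ) ^ 2 := by
      rw [← hzN]
      have : (z.num : ℚ) = z * z.den := (Rat.mul_den_eq_num z).symm
      rw [this]; ring
    exact_mod_cast h1
  have hcop : IsCoprime ((z.den : ℤ) ^ 2) (z.num ^ 2) := by
    have : IsCoprime z.num (z.den : ℤ) := by
      rw [Int.isCoprime_iff_gcd_eq_one]
      simpa [Int.gcd] using z.reduced
    exact (this.symm).pow
  have hdvd : (z.den : ℤ) * (z.den : ℤ) ∣ d := by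
    rw [← sq]
    exact hcop.dvd_of_dvd_mul_right ⟨N, by rw [hab]; ring⟩
  have hu : (z.den : ℤ) ^ 2 = 1 := by
    rcases Int.isUnit_iff.mp (hsq _ hdvd) with h | h <;> rw [h] <;> norm_num
  rw [hu, mul_one] at hab
  have hnum : 1 ≤ z.num ^ 2 := by
    have : z.num ≠ 0 := Rat.num_ne_zero.mpr hz0
    have : 0 < z.num ^ 2 := by positivity
    omega
  have hdN : d ≤ N := by rw [← hab]; nlinarith
  have hdNR : (d : ℝ) ≤ (q : ℝ) * ((p : ℝ) ^ 3 + A * p * (q : ℝ) ^ 2 + B * (q : ℝ) ^ 3) := by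
    rw [hN] at hdN
    exact_mod_cast hdN
  obtain ⟨M, hM⟩ : ∃ M : ℝ, M = max |(p : ℝ)| (q : ℝ) := ⟨_, rfl⟩
  rw [← hM]
  have hpM : |(p : ℝ)| ≤ M := hM ▸ le_max_left _ _
  have hqM : (q : ℝ) ≤ M := hM ▸ le_max_right _ _
  have hq1 : (1 : ℝ) ≤ q := by exact_mod_cast hq
  have hM0 : 0 ≤ M := by linarith
  have hbound : (d : ℝ) ≤ K * M ^ 4 := by
    have e1 : (q : ℝ) * (p : ℝ) ^ 3 ≤ M ^ 4 := by
      calc (q : ℝ) * (p : ℝ) ^ 3 ≤ q * |(p : ℝ)| ^ 3 := by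
            rw [← abs_pow]; gcongr; exact le_abs_self _
        _ ≤ M * M ^ 3 := by gcongr
        _ = M ^ 4 := by ring
    have e2 : (A : ℝ) * p * (q : ℝ) ^ 3 ≤ |(A : ℝ)| * M ^ 4 := by
      calc (A : ℝ) * p * (q : ℝ) ^ 3 ≤ |(A : ℝ)| * |(p : ℝ)| * (q : ℝ) ^ 3 := by
            rw [← abs_mul]; gcongr; exact le_abs_self _
        _ ≤ |(A : ℝ)| * M * M ^ 3 := by gcongr
        _ = |(A : ℝ)| * M ^ 4 := by ring
    have e3 : (B : ℝ) * (q : ℝ) ^ 4 ≤ |(B : ℝ)| * M ^ 4 := by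
      calc (B : ℝ) * (q : ℝ) ^ 4 ≤ |(B : ℝ)| * (q : ℝ) ^ 4 := by
            gcongr; exact le_abs_self _
        _ ≤ |(B : ℝ)| * M ^ 4 := by gcongr
    rw [hKdef]
    nlinarith
  have hd0 : (0 : ℝ) ≤ d := by exact_mod_cast (by omega : (0 : ℤ) ≤ d)
  have hr : ((d : ℝ) ^ ((1 : ℝ) / 4)) ^ 4 = d := by
    rw [← Real.rpow_natCast, ← Real.rpow_mul hd0]; norm_num
  have hK0 : 0 < K := by linarith
  have hfin : (d : ℝ) ^ ((1 : ℝ) / 4) ≤ K * M := by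
    refine le_of_pow_le_pow_left₀ (n := 4) (by norm_num) (by positivity) ?_
    rw [hr, mul_pow]
    refine hbound.trans ?_
    gcongr
    exact le_self_pow₀ hK (by norm_num)
  rw [ge_iff_le, one_div, inv_mul_le_iff₀ hK0]
  exact hfin
end

section
/- Let $(A,B) \in \mathbb{Z}^2$ with $4A^3 + 27B^2 \neq 0$ and fix $\varepsilon \in (0, 1/2)$. For $X \geq 1$, let $N(X)$ denote the number of squarefree integers $d$ with $1 \leq d \leq X$ for which there exist coprime integers $(p,q)$ with $q \geq 1$ and a rational number $y \neq 0$ such that $d y^2 = (p/q)^3 + A (p/q) + B$ and $\max\{|p|, q\} \leq d^{1/2 - \varepsilon}$. Then $N(X)/X \to 0$ as $X \to \infty$. -/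
open Filter

/-- A positive squarefree integer is determined by its class modulo rational squares. -/
lemma squarefree_class_unique (d e : ℤ) (hd : 1 ≤ d) (he : 1 ≤ e) (sd : Squarefree d)
    (se : Squarefree e) (y z : ℚ) (hz : z ≠ 0)
    (h : (d : ℚ) * y ^ 2 = (e : ℚ) * z ^ 2) : d = e := by
  have h1 : IsSquare ((d * e : ℤ) : ℚ) := by
    refine ⟨d * y / z, ?_⟩
    push_cast
    field_simp
    linear_combination -h
  rw [Rat.isSquare_intCast_iff] at h1
  obtain ⟨m, hm⟩ := h1
  have h2 : d ∣ m := by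
    have : d ∣ m ^ 2 := ⟨e, by rw [hm]; ring⟩
    exact (sd.dvd_pow_iff_dvd (by norm_num)).1 this
  obtain ⟨k, rfl⟩ := h2
  have h3 : e = d * (k * k) := by
    have : d ≠ 0 := by omega
    apply mul_left_cancel₀ this
    rw [hm]; ring
  have h4 : IsUnit k := se k ⟨d, by rw [h3]; ring⟩
  have h5 : k * k = 1 := Int.isUnit_mul_self h4
  rw [h3, h5, mul_one]

/-- Naive-height form of Theorem 1: for almost every squarefree `d`, every
rational point with nonzero y-coordinate on `d y² = x³ + A x + B` has naive
x-height exceeding `d^{1/2-ε}`. -/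
theorem stmt_10 (A B : ℤ) (hAB : 4 * A ^ 3 + 27 * B ^ 2 ≠ 0)
    (ε : ℝ) (hε : 0 < ε) (hε' : ε < 1 / 2) :
    Tendsto (fun X : ℝ =>
      (Set.ncard { d : ℤ | 1 ≤ d ∧ (d : ℝ) ≤ X ∧ Squarefree d ∧
        ∃ p q : ℤ, ∃ y : ℚ, Int.gcd p q = 1 ∧ 1 ≤ q ∧ y ≠ 0 ∧
          (d : ℚ) * y ^ 2 = ((p : ℚ) / (q : ℚ)) ^ 3 + (A : ℚ) * ((p : ℚ) / (q : ℚ)) + (B : ℚ) ∧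
          max |(p : ℝ)| (q : ℝ) ≤ (d : ℝ) ^ ((1 : ℝ) / 2 - ε) } : ℝ) / X)
      atTop (nhds 0) := by
  have key : ∀ X : ℝ, 1 ≤ X → (Set.ncard { d : ℤ | 1 ≤ d ∧ (d : ℝ) ≤ X ∧ Squarefree d ∧
        ∃ p q : ℤ, ∃ y : ℚ, Int.gcd p q = 1 ∧ 1 ≤ q ∧ y ≠ 0 ∧
          (d : ℚ) * y ^ 2 = ((p : ℚ) / (q : ℚ)) ^ 3 + (A : ℚ) * ((p : ℚ) / (q : ℚ)) + (B : ℚ) ∧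
          max |(p : ℝ)| (q : ℝ) ≤ (d : ℝ) ^ ((1 : ℝ) / 2 - ε) } : ℝ) / X
        ≤ 3 * X ^ (-(2 * ε)) := by
    intro X hX
    have hX0 : 0 < X := by linarith
    set S := { d : ℤ | 1 ≤ d ∧ (d : ℝ) ≤ X ∧ Squarefree d ∧
        ∃ p q : ℤ, ∃ y : ℚ, Int.gcd p q = 1 ∧ 1 ≤ q ∧ y ≠ 0 ∧
          (d : ℚ) * y ^ 2 = ((p : ℚ) / (q : ℚ)) ^ 3 + (A : ℚ) * ((p : ℚ) / (q : ℚ)) + (B : ℚ) ∧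
          max |(p : ℝ)| (q : ℝ) ≤ (d : ℝ) ^ ((1 : ℝ) / 2 - ε) } with hS
    set T : ℕ := ⌊X ^ ((1 : ℝ) / 2 - ε)⌋₊ with hT
    have hpos : 0 ≤ X ^ ((1 : ℝ) / 2 - ε) := by positivity
    have hTle : (T : ℝ) ≤ X ^ ((1 : ℝ) / 2 - ε) := Nat.floor_le hpos
    have hbd : ∀ n : ℤ, (n : ℝ) ≤ X ^ ((1 : ℝ) / 2 - ε) → n ≤ T := by
      intro n hn
      rw [hT, Int.natCast_floor_eq_floor hpos]
      exact Int.le_floor.2 hn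
    have ex : ∀ d : ℤ, ∃ r : ℤ × ℤ, d ∈ S → (r ∈ Finset.Icc (-(T : ℤ)) T ×ˢ Finset.Icc (1 : ℤ) T ∧
        ∃ y : ℚ, y ≠ 0 ∧ (d : ℚ) * y ^ 2 =
          ((r.1 : ℚ) / (r.2 : ℚ)) ^ 3 + (A : ℚ) * ((r.1 : ℚ) / (r.2 : ℚ)) + (B : ℚ)) := by
      intro d
      by_cases h : d ∈ S
      · obtain ⟨h1, hdX, -, p, q, y, -, hq, hy, heq, hmax⟩ := h
        refine ⟨(p, q), fun _ => ⟨?_, y, hy, heq⟩⟩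
        have hd0 : (0 : ℝ) ≤ d := by exact_mod_cast (by omega : (0 : ℤ) ≤ d)
        have hmono : (d : ℝ) ^ ((1 : ℝ) / 2 - ε) ≤ X ^ ((1 : ℝ) / 2 - ε) :=
          Real.rpow_le_rpow hd0 hdX (by linarith)
        have hm := hmax.trans hmono
        rw [max_le_iff, abs_le] at hm
        obtain ⟨⟨ha, hb⟩, hc⟩ := hm
        have h1 := hbd p hb
        have h2 := hbd q hc
        have h3 := hbd (-p) (by push_cast; linarith)
        simp only [Finset.mem_product, Finset.mem_Icc]
        omega
      · exact ⟨(0, 0), fun h' => absurd h' h⟩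
    choose f hf using ex
    have hcard : S.ncard ≤ (2 * T + 1) * T := by
      have := Set.ncard_le_ncard_of_injOn (s := S)
        (t := ((Finset.Icc (-(T : ℤ)) T ×ˢ Finset.Icc (1 : ℤ) T : Finset (ℤ × ℤ)) : Set (ℤ × ℤ))) f
        (fun d hd => (hf d hd).1) (by
          intro d hd e he hde
          obtain ⟨-, y, hy, h1⟩ := hf d hd
          obtain ⟨-, z, hz, h2⟩ := hf e he
          rw [hde] at h1
          exact squarefree_class_unique d e hd.1 he.1 hd.2.2.1 he.2.2.1 y z hz (h1.trans h2.symm))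
        (Finset.finite_toSet _)
      rw [Set.ncard_coe_finset, Finset.card_product, Int.card_Icc, Int.card_Icc] at this
      convert this using 2 <;> omega
    have hcard2 : S.ncard ≤ 3 * T ^ 2 := by
      refine hcard.trans ?_
      rcases Nat.eq_zero_or_pos T with h | h
      · simp [h]
      · nlinarith
    have hcard3 : (S.ncard : ℝ) ≤ 3 * (T : ℝ) ^ 2 := by exact_mod_cast hcard2
    rw [div_le_iff₀ hX0]
    have e1 : X ^ (-(2 * ε)) * X = (X ^ ((1 : ℝ) / 2 - ε)) ^ 2 := by
      rw [← Real.rpow_natCast, ← Real.rpow_mul hX0.le, ← Real.rpow_add_one hX0.ne']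
      congr 1
      push_cast
      ring
    rw [mul_assoc, e1]
    have : (T : ℝ) ^ 2 ≤ (X ^ ((1 : ℝ) / 2 - ε)) ^ 2 := by gcongr
    linarith
  have lim : Tendsto (fun X : ℝ => 3 * X ^ (-(2 * ε))) atTop (nhds 0) := by
    simpa using (tendsto_rpow_neg_atTop (show 0 < 2 * ε by linarith)).const_mul 3
  refine tendsto_of_tendsto_of_tendsto_of_le_of_le' tendsto_const_nhds lim ?_ ?_
  · filter_upwards [eventually_ge_atTop 1] with X hX
    positivity
  · filter_upwards [eventually_ge_atTop 1] with X hX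
    exact key X hX
end
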